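/- arXiv:2103.13162 — 16 statements merged into one kernel-verified Lean document; each statement's English description precedes it below -/
import Mathlib

section
/- For every separation system S (a poset equipped with an involutive antitone map * : S → S) there exist a lattice U, an involutive antitone map ⊛ : U → U, and a map φ : S → U such that: φ is an order embedding (φ(r) ≤ φ(s) if and only if r ≤ s); φ(s*) = (φ(s))⊛ for all s ∈ S; for all r, s, t ∈ S, φ(t) = φ(r) ⊔ φ(s) if and only if t is the least upper bound of r and s in the poset S; and φ(t) = φ(r) ⊓ φ(s) if and only if t is the greatest lower bound of r and s in the poset S. Moreover, if S is finite then U can be chosen to be finite. -/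
universe u

/-- A universe of separations: a lattice together with an involutive,
order-reversing (antitone) map. -/
structure SepUniverse where
  carrier : Type u
  [lat : Lattice carrier]
  inv : carrier → carrier
  inv_invol : ∀ u, inv (inv u) = u
  inv_anti : ∀ u v : carrier, u ≤ v → inv v ≤ inv u

attribute [instance] SepUniverse.lat

namespace DedekindCut

theorem principal_eq_sup_iff {α : Type*} [PartialOrder α] {r s t : α} :
    principal t = principal r ⊔ principal s ↔ IsLUB {r, s} t := by
  rw [isLUB_iff_le_iff, ← Concept.intent_injective.eq_iff, Set.ext_iff]
  simp [upperBounds_insert]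

theorem principal_eq_inf_iff {α : Type*} [PartialOrder α] {r s t : α} :
    principal t = principal r ⊓ principal s ↔ IsGLB {r, s} t := by
  rw [isGLB_iff_le_iff, ← Concept.extent_injective.eq_iff, Set.ext_iff]
  simp [lowerBounds_insert]

instance {α : Type*} [Preorder α] [Finite α] : Finite (DedekindCut α) :=
  Finite.of_injective _ Concept.extent_injective

/-- The image of a cut under an order-reversing involution. -/
def reflect {α : Type*} [Preorder α] (f : α → α) (hf : Function.Involutive f)
    (hanti : Antitone f) (A : DedekindCut α) : DedekindCut α where
  extent := f ⁻¹' A.right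
  intent := f ⁻¹' A.left
  upperPolar_extent := by
    ext x
    rw [Set.mem_preimage, ← A.lowerBounds_right]
    refine ⟨fun h y hy => ?_, fun h y hy => ?_⟩
    · have hy' : f y ∈ f ⁻¹' A.right := by rwa [Set.mem_preimage, hf y]
      simpa only [hf y] using hanti (h hy')
    · simpa only [hf x, hf y] using hanti (h hy)
  lowerPolar_intent := by
    ext x
    rw [Set.mem_preimage, ← A.upperBounds_left]
    refine ⟨fun h y hy => ?_, fun h y hy => ?_⟩
    · have hy' : f y ∈ f ⁻¹' A.left := by rwa [Set.mem_preimage, hf y]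
      simpa only [hf y] using hanti (h hy')
    · simpa only [hf x, hf y] using hanti (h hy)

section reflect

variable {α : Type*} [Preorder α] {f : α → α} (hf : Function.Involutive f) (hanti : Antitone f)

theorem reflect_involutive : Function.Involutive (reflect f hf hanti) := fun A => by
  ext x
  change f (f x) ∈ A.left ↔ x ∈ A.left
  rw [hf x]

theorem reflect_antitone : Antitone (reflect f hf hanti) := fun _ _ h =>
  Concept.extent_subset_extent_iff.1 (Set.preimage_mono (Concept.intent_subset_intent_iff.2 h))

theorem reflect_principal (a : α) : reflect f hf hanti (principal a) = principal (f a) := by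
  ext x
  change a ≤ f x ↔ x ≤ f a
  exact ⟨fun h => by simpa only [hf x] using hanti h, fun h => by simpa only [hf a] using hanti h⟩

end reflect

end DedekindCut

/-- Every separation system embeds into a universe of separations, preserving
the involution and reflecting joins/meets to existing suprema/infima; the
universe can be chosen finite when the separation system is finite. -/
theorem every_sepSystem_embeds_into_universe {α : Type u} [PartialOrder α]
    (star : α → α) (hinv : ∀ s, star (star s) = s)
    (hanti : ∀ r s : α, r ≤ s → star s ≤ star r) :
    ∃ (W : SepUniverse.{u}) (φ : α → W.carrier),
      (∀ r s : α, φ r ≤ φ s ↔ r ≤ s) ∧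
      (∀ s : α, φ (star s) = W.inv (φ s)) ∧
      (∀ r s t : α, φ t = φ r ⊔ φ s ↔ IsLUB {r, s} t) ∧
      (∀ r s t : α, φ t = φ r ⊓ φ s ↔ IsGLB {r, s} t) ∧
      (Finite α → Finite W.carrier) := by
  have hf : Function.Involutive star := hinv
  have hstar : Antitone star := hanti
  exact ⟨{ carrier := DedekindCut α
           inv := DedekindCut.reflect star hf hstar
           inv_invol := DedekindCut.reflect_involutive hf hstar
           inv_anti := fun _ _ h => DedekindCut.reflect_antitone hf hstar h },
    DedekindCut.principal,
    fun _ _ => DedekindCut.principal_le_principal,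
    fun s => (DedekindCut.reflect_principal hf hstar s).symm,
    fun _ _ _ => DedekindCut.principal_eq_sup_iff,
    fun _ _ _ => DedekindCut.principal_eq_inf_iff,
    fun _ => inferInstanceAs (Finite (DedekindCut α))⟩
end

section
/- Every finite submodular separation system is submodular in some universe of separations: if S is a finite poset with an involutive antitone map * : S → S such that every pair r, s ∈ S has a least upper bound in S or a greatest lower bound in S, then there exist a finite lattice U with an involutive antitone map ⊛ : U → U and an order embedding φ : S → U satisfying φ(s*) = (φ(s))⊛, which maps existing least upper bounds in S to joins in U and existing greatest lower bounds in S to meets in U, and such that the image φ(S) is submodular in U, i.e., for all a, b ∈ φ(S), a ⊔ b ∈ φ(S) or a ⊓ b ∈ φ(S). -/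
universe u

namespace DedekindCut

section Preorder

variable {α : Type u} [Preorder α]

/-- An order-reversing involution of a preorder extends to its Dedekind cuts by exchanging the
left and right sets and taking preimages. -/
def involution (star : α → α) (hinv : Function.Involutive star) (hanti : Antitone star)
    (A : DedekindCut α) : DedekindCut α where
  extent := star ⁻¹' A.right
  intent := star ⁻¹' A.left
  upperPolar_extent := by
    ext x
    rw [Set.mem_preimage, ← lowerBounds_right]
    refine ⟨fun h y hy => ?_, fun h y hy => ?_⟩
    · have hy' : star y ∈ star ⁻¹' A.right := by rwa [Set.mem_preimage, hinv y]
      simpa only [hinv y] using hanti (h hy')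
    · simpa only [hinv x, hinv y] using hanti (h hy)
  lowerPolar_intent := by
    ext x
    rw [Set.mem_preimage, ← upperBounds_left]
    refine ⟨fun h y hy => ?_, fun h y hy => ?_⟩
    · have hy' : star y ∈ star ⁻¹' A.left := by rwa [Set.mem_preimage, hinv y]
      simpa only [hinv y] using hanti (h hy')
    · simpa only [hinv x, hinv y] using hanti (h hy)

variable {star : α → α} (hinv : Function.Involutive star) (hanti : Antitone star)

theorem involution_involutive : Function.Involutive (involution star hinv hanti) := fun A =>
  ext <| Set.ext fun x => by
    change star (star x) ∈ A.left ↔ x ∈ A.left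
    rw [hinv x]

theorem involution_antitone : Antitone (involution star hinv hanti) := fun _ _ h =>
  Concept.extent_subset_extent_iff.1 <|
    Set.preimage_mono (Concept.intent_subset_intent_iff.2 h)

theorem involution_principal (a : α) :
    involution star hinv hanti (principal a) = principal (star a) := by
  ext x
  change a ≤ star x ↔ x ≤ star a
  exact ⟨fun h => by simpa only [hinv x] using hanti h,
    fun h => by simpa only [hinv a] using hanti h⟩

theorem principal_eq_sup {a b c : α} (h : IsLUB {a, b} c) :
    principal c = principal a ⊔ principal b := by
  apply ext'
  ext x
  simpa [Concept.intent_sup] using isLUB_le_iff h (b := x)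

theorem principal_eq_inf {a b c : α} (h : IsGLB {a, b} c) :
    principal c = principal a ⊓ principal b := by
  ext x
  simpa [Concept.extent_inf] using le_isGLB_iff h (b := x)

end Preorder

end DedekindCut

/-- Every finite submodular separation system is submodular in some (finite)
universe of separations. -/
theorem submodular_sepSystem_submodular_in_universe {α : Type u} [PartialOrder α]
    [Finite α] (star : α → α) (hinv : ∀ s, star (star s) = s)
    (hanti : ∀ r s : α, r ≤ s → star s ≤ star r)
    (hsubmod : ∀ r s : α, (∃ t, IsLUB {r, s} t) ∨ (∃ t, IsGLB {r, s} t)) :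
    ∃ (W : SepUniverse.{u}) (φ : α → W.carrier),
      Finite W.carrier ∧
      (∀ r s : α, φ r ≤ φ s ↔ r ≤ s) ∧
      (∀ s : α, φ (star s) = W.inv (φ s)) ∧
      (∀ r s t : α, IsLUB {r, s} t → φ t = φ r ⊔ φ s) ∧
      (∀ r s t : α, IsGLB {r, s} t → φ t = φ r ⊓ φ s) ∧
      (∀ a ∈ Set.range φ, ∀ b ∈ Set.range φ,
        a ⊔ b ∈ Set.range φ ∨ a ⊓ b ∈ Set.range φ) := by
  have star_invol : Function.Involutive star := hinv
  have star_anti : Antitone star := fun r s => hanti r s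
  refine ⟨⟨DedekindCut α, DedekindCut.involution star star_invol star_anti,
    DedekindCut.involution_involutive star_invol star_anti,
    fun _ _ h => DedekindCut.involution_antitone star_invol star_anti h⟩,
    DedekindCut.principal, Finite.of_injective _ Concept.extent_injective,
    fun _ _ => DedekindCut.principal_le_principal,
    fun s => (DedekindCut.involution_principal star_invol star_anti s).symm,
    fun _ _ _ => DedekindCut.principal_eq_sup, fun _ _ _ => DedekindCut.principal_eq_inf, ?_⟩
  rintro _ ⟨r, rfl⟩ _ ⟨s, rfl⟩
  exact (hsubmod r s).imp (fun ⟨t, ht⟩ => ⟨t, DedekindCut.principal_eq_sup ht⟩)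
    (fun ⟨t, ht⟩ => ⟨t, DedekindCut.principal_eq_inf ht⟩)
end

section
/- Let L be a lattice, let f : L → ℝ be a nonnegative submodular function, let k ∈ ℝ, and set P = {a ∈ L | f(a) < k}. If (a, b) is an edge of the dependency digraph of P in L, then f(a) > f(b). -/
/-- The edge relation of the dependency digraph of a subset `P` of a lattice `L`. -/
def DepEdge {L : Type*} [Lattice L] (P : Set L) (a b : L) : Prop :=
  (a ∉ P ∧ b ∈ P) ∨
  (a ∈ P ∧ b ∈ P ∧ ∃ c ∈ P,
    (b = a ⊔ c ∧ a ⊓ c ∉ P) ∨ (b = a ⊓ c ∧ a ⊔ c ∉ P)) ∨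
  (a ∉ P ∧ b ∉ P ∧ ∃ c ∈ P,
    (b = a ⊔ c ∧ a ⊓ c ∉ P) ∨ (b = a ⊓ c ∧ a ⊔ c ∉ P))

/-- If the submodularity of `P` in `L` is induced by a nonnegative submodular
function `f` and threshold `k`, then along every edge `(a, b)` of the
dependency digraph of `P` the value of `f` strictly decreases. -/
theorem depEdge_lt {L : Type*} [Lattice L] (f : L → ℝ)
    (hf0 : ∀ a, 0 ≤ f a)
    (hsub : ∀ a b : L, f (a ⊔ b) + f (a ⊓ b) ≤ f a + f b)
    (k : ℝ) (P : Set L) (hP : P = {a : L | f a < k})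
    (a b : L) (hab : DepEdge P a b) :
    f b < f a := by
  subst hP
  simp only [DepEdge, Set.mem_ofPred_eq, not_lt] at hab
  rcases hab with ⟨ha, hb⟩ | ⟨-, -, c, hc, ⟨rfl, h⟩ | ⟨rfl, h⟩⟩ | ⟨-, -, c, hc, ⟨rfl, h⟩ | ⟨rfl, h⟩⟩
  · exact hb.trans_le ha
  all_goals linarith [hsub a c]
end

section
/- Let L be a lattice and P ⊆ L. If the dependency digraph of P contains a directed cycle, i.e., a sequence a₀, a₁, …, a_n of vertices with n ≥ 1, a₀ = a_n, and an edge from a_i to a_{i+1} for every i < n, then P is not order-induced submodular in L: there exist no nonnegative submodular function f : L → ℝ and no k ∈ ℝ with P = {a ∈ L | f(a) < k}. -/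
/-- A submodular function whose strict sublevel set is `P` strictly decreases along every edge of
the dependency digraph of `P`. -/
theorem DepEdge.lt {L : Type*} [Lattice L] {f : L → ℝ} {k : ℝ}
    (hf : ∀ x y : L, f (x ⊔ y) + f (x ⊓ y) ≤ f x + f y) {a b : L}
    (h : DepEdge {x : L | f x < k} a b) : f b < f a := by
  have step : (∃ c ∈ {x : L | f x < k}, (b = a ⊔ c ∧ a ⊓ c ∉ {x : L | f x < k}) ∨
      (b = a ⊓ c ∧ a ⊔ c ∉ {x : L | f x < k})) → f b < f a := by
    rintro ⟨c, hc, ⟨rfl, hac⟩ | ⟨rfl, hac⟩⟩ <;>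
    · simp only [Set.mem_ofPred_eq, not_lt] at hc hac
      linarith [hf a c]
  rcases h with ⟨ha, hb⟩ | ⟨-, -, h⟩ | ⟨-, -, h⟩
  · exact lt_of_lt_of_le hb (not_lt.mp ha)
  · exact step h
  · exact step h

/-- If the dependency digraph of `P` contains a directed cycle, then `P` is not
order-induced submodular in `L`. -/
theorem not_orderInduced_of_cycle {L : Type*} [Lattice L] (P : Set L)
    (a : ℕ → L) (n : ℕ) (hn : 1 ≤ n) (hcyc : a 0 = a n)
    (hedge : ∀ i < n, DepEdge P (a i) (a (i + 1))) :
    ¬ ∃ (f : L → ℝ) (k : ℝ), (∀ x, 0 ≤ f x) ∧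
        (∀ x y : L, f (x ⊔ y) + f (x ⊓ y) ≤ f x + f y) ∧
        P = {x : L | f x < k} := by
  rintro ⟨f, k, -, hf, rfl⟩
  have decreasing : ∀ m, 1 ≤ m → m ≤ n → f (a m) < f (a 0) := by
    intro m hm
    induction m, hm using Nat.le_induction with
    | base => exact fun h => (hedge 0 h).lt hf
    | succ m _ ih => exact fun h => ((hedge m h).lt hf).trans (ih (Nat.le_of_succ_le h))
  exact (decreasing n hn le_rfl).ne (congrArg f hcyc.symm)
end

section
/- Let L be a lattice and let P ⊆ L be submodular in L, i.e., for all a, b ∈ P at least one of a ⊔ b and a ⊓ b lies in P. Then the dependency digraph of P contains no directed cycle of length two: there are no distinct a, b ∈ L such that both (a, b) and (b, a) are edges of the dependency digraph of P. -/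
/-- If `a = b ⊓ d` and `b = a ⊔ c`, then `c ⊔ d = b ⊔ d` and `c ⊓ d = a ⊓ c`. -/
theorem sup_eq_and_inf_eq_of_eq_sup_of_eq_inf {L : Type*} [Lattice L] {a b c d : L}
    (hb : b = a ⊔ c) (ha : a = b ⊓ d) : c ⊔ d = b ⊔ d ∧ c ⊓ d = a ⊓ c := by
  have had : a ≤ d := ha.trans_le inf_le_right
  have hcb : c ≤ b := le_sup_right.trans_eq hb.symm
  constructor
  · rw [hb, sup_assoc, sup_eq_right.2 (had.trans le_sup_right)]
  · rw [ha, inf_right_comm, inf_eq_right.2 hcb]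

/-- In a submodular subset, a join step from `a` to `b` and a meet step back from `b` to `a`
cannot both be forced. -/
theorem false_of_sup_step_of_inf_step {L : Type*} [Lattice L] {P : Set L}
    (hsubmod : ∀ a ∈ P, ∀ b ∈ P, a ⊔ b ∈ P ∨ a ⊓ b ∈ P) {a b c d : L}
    (hc : c ∈ P) (hd : d ∈ P) (hb : b = a ⊔ c) (hac : a ⊓ c ∉ P)
    (ha : a = b ⊓ d) (hbd : b ⊔ d ∉ P) : False := by
  obtain ⟨h₁, h₂⟩ := sup_eq_and_inf_eq_of_eq_sup_of_eq_inf hb ha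
  rcases hsubmod c hc d hd with h | h
  · exact hbd (h₁ ▸ h)
  · exact hac (h₂ ▸ h)

/-- If `P` is submodular in the lattice `L`, then the dependency digraph of `P`
contains no directed cycle of length two. -/
theorem no_two_cycle_of_submodular {L : Type*} [Lattice L] (P : Set L)
    (hsubmod : ∀ a ∈ P, ∀ b ∈ P, a ⊔ b ∈ P ∨ a ⊓ b ∈ P) :
    ¬ ∃ a b : L, a ≠ b ∧ DepEdge P a b ∧ DepEdge P b a := by
  rintro ⟨a, b, hne, hab, hba⟩
  have step : ∀ {x y : L}, DepEdge P x y → (x ∈ P ↔ y ∈ P) → ∃ c ∈ P,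
      (y = x ⊔ c ∧ x ⊓ c ∉ P) ∨ (y = x ⊓ c ∧ x ⊔ c ∉ P) := by
    rintro x y (⟨hx, hy⟩ | ⟨-, -, h⟩ | ⟨-, -, h⟩) hxy
    · exact absurd (hxy.2 hy) hx
    · exact h
    · exact h
  have hiff : a ∈ P ↔ b ∈ P := by
    unfold DepEdge at hab hba
    tauto
  obtain ⟨c, hc, ⟨hb, hac⟩ | ⟨hb, hac⟩⟩ := step hab hiff <;>
  obtain ⟨d, hd, ⟨ha, hbd⟩ | ⟨ha, hbd⟩⟩ := step hba hiff.symm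
  · exact hne (le_antisymm (le_sup_left.trans_eq hb.symm) (le_sup_left.trans_eq ha.symm))
  · exact false_of_sup_step_of_inf_step hsubmod hc hd hb hac ha hbd
  · exact false_of_sup_step_of_inf_step hsubmod hd hc ha hbd hb hac
  · exact hne (le_antisymm (ha.trans_le inf_le_left) (hb.trans_le inf_le_left))
end

section
/- There exist a finite type V (one may take V with exactly six elements) and a set S of subsets of V which is closed under complementation (A ∈ S implies V ∖ A ∈ S) and submodular in the bipartition universe on V (for all A, B ∈ S, A ∪ B ∈ S or A ∩ B ∈ S), such that there exist no nonnegative submodular function f on the lattice of all subsets of V satisfying f(A) = f(V ∖ A) for all A ⊆ V, and no k ∈ ℝ, with S = {A ⊆ V | f(A) < k}. -/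
/-- A complement-closed family of subsets of a six-element set, consisting of the empty set,
three singletons, three pairs, three triples, and their complements. -/
def cyclicBipartitions : Finset (Finset (Fin 6)) :=
  let L : Finset (Finset (Fin 6)) :=
    {∅, {0}, {1}, {2}, {0, 4}, {1, 3}, {2, 5}, {0, 1, 4}, {1, 2, 3}, {0, 2, 5}}
  L ∪ L.image fun a => aᶜ

lemma compl_mem_cyclicBipartitions :
    ∀ a ∈ cyclicBipartitions, aᶜ ∈ cyclicBipartitions := by
  decide +kernel

lemma union_or_inter_mem_cyclicBipartitions :
    ∀ a ∈ cyclicBipartitions, ∀ b ∈ cyclicBipartitions,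
      a ∪ b ∈ cyclicBipartitions ∨ a ∩ b ∈ cyclicBipartitions := by
  decide +kernel

/-- If `g` is submodular and `b` lies below level `k` while `a ∪ b` does not, then `a ∩ b` has
smaller order than `a`. -/
lemma inter_lt_of_submodular {α : Type*} [DecidableEq α] {g : Finset α → ℝ} {k : ℝ}
    (hsub : ∀ a b, g (a ∪ b) + g (a ∩ b) ≤ g a + g b) {a b : Finset α}
    (hb : g b < k) (hab : ¬ g (a ∪ b) < k) : g (a ∩ b) < g a := by
  linarith [hsub a b]

/-- No symmetric submodular function has `cyclicBipartitions` as a strict sublevel set: it would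
decrease strictly along the cycle `{1, 4}`, `{2, 3}`, `{0, 5}`, `{1, 4}`. -/
lemma cyclicBipartitions_not_sublevel (g : Finset (Fin 6) → ℝ) (k : ℝ)
    (hsub : ∀ a b, g (a ∪ b) + g (a ∩ b) ≤ g a + g b) (hsymm : ∀ a, g a = g aᶜ)
    (hmem : ∀ a, a ∈ cyclicBipartitions ↔ g a < k) : False := by
  have step (a b c : Finset (Fin 6)) (hb : b ∈ cyclicBipartitions)
      (hab : aᶜ ∪ b ∉ cyclicBipartitions) (hc : aᶜ ∩ b = c) : g c < g a := by
    rw [hsymm a, ← hc]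
    exact inter_lt_of_submodular hsub ((hmem b).1 hb) fun h => hab ((hmem _).2 h)
  have h₁ : g {2, 3} < g {1, 4} :=
    step _ {1, 2, 3} _ (by decide +kernel) (by decide +kernel) (by decide +kernel)
  have h₂ : g {0, 5} < g {2, 3} :=
    step _ {0, 2, 5} _ (by decide +kernel) (by decide +kernel) (by decide +kernel)
  have h₃ : g {1, 4} < g {0, 5} :=
    step _ {0, 1, 4} _ (by decide +kernel) (by decide +kernel) (by decide +kernel)
  exact lt_asymm h₁ (h₃.trans h₂)

/-- There is a separation system of bipartitions of a finite set which is
submodular in the bipartition universe, but whose submodularity is not induced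
by any submodular order function. -/
theorem exists_submodular_bipartition_system_not_orderInduced :
    ∃ (V : Type), Finite V ∧
      ∃ S : Set (Set V),
        (∀ A ∈ S, Aᶜ ∈ S) ∧
        (∀ A ∈ S, ∀ B ∈ S, A ∪ B ∈ S ∨ A ∩ B ∈ S) ∧
        ¬ ∃ (f : Set V → ℝ) (k : ℝ), (∀ A : Set V, 0 ≤ f A) ∧
            (∀ A B : Set V, f (A ∪ B) + f (A ∩ B) ≤ f A + f B) ∧
            (∀ A : Set V, f A = f Aᶜ) ∧
            S = {A : Set V | f A < k} := by
  refine ⟨Fin 6, inferInstance, (fun a : Finset (Fin 6) => (a : Set (Fin 6))) ''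
    {a | a ∈ cyclicBipartitions}, ?_, ?_, ?_⟩
  · rintro _ ⟨a, ha, rfl⟩
    exact ⟨aᶜ, compl_mem_cyclicBipartitions a ha, Finset.coe_compl a⟩
  · rintro _ ⟨a, ha, rfl⟩ _ ⟨b, hb, rfl⟩
    exact (union_or_inter_mem_cyclicBipartitions a ha b hb).imp
      (fun h => ⟨a ∪ b, h, Finset.coe_union a b⟩) (fun h => ⟨a ∩ b, h, Finset.coe_inter a b⟩)
  · rintro ⟨f, k, -, hsub, hsymm, hS⟩
    refine cyclicBipartitions_not_sublevel (fun a => f a) k (fun a b => ?_) (fun a => ?_)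
      (fun a => ?_)
    · simpa only [Finset.coe_union, Finset.coe_inter] using hsub a b
    · simpa only [Finset.coe_compl] using hsymm a
    · exact (Finset.coe_injective.mem_set_image (s := {a | a ∈ cyclicBipartitions})).symm.trans
        (Set.ext_iff.1 hS a)
end

section
/- There exists a finite submodular separation system S (a finite poset with an involutive antitone map * such that every pair of elements of S has a least upper bound in S or a greatest lower bound in S) with the following property: for every lattice U with an involutive antitone map ⊛ and every order embedding φ : S → U satisfying φ(s*) = (φ(s))⊛ for all s, which preserves pre-existing binary joins and meets (whenever t is the least upper bound of r and s in S then φ(t) = φ(r) ⊔ φ(s), and whenever t is the greatest lower bound of r and s in S then φ(t) = φ(r) ⊓ φ(s)), the image φ(S) is not order-induced submodular in U: there exist no nonnegative submodular function f : U → ℝ with f(u) = f(u⊛) for all u ∈ U and no k ∈ ℝ with φ(S) = {u ∈ U | f(u) < k}. -/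
/-- A finite submodular separation system: a finite poset with an involutive
antitone map in which any two elements have a least upper bound or a greatest
lower bound. -/
structure FinSubmodSepSys where
  carrier : Type
  [po : PartialOrder carrier]
  [fin : Finite carrier]
  inv : carrier → carrier
  inv_invol : ∀ s, inv (inv s) = s
  inv_anti : ∀ r s : carrier, r ≤ s → inv s ≤ inv r
  submod : ∀ r s : carrier, (∃ t, IsLUB {r, s} t) ∨ (∃ t, IsGLB {r, s} t)

attribute [instance] FinSubmodSepSys.po FinSubmodSepSys.fin

/-- The underlying set of the witness separation system. -/
def Witness : Type := Fin 14

namespace Witness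

instance : Fintype Witness := inferInstanceAs (Fintype (Fin 14))

instance : DecidableEq Witness := inferInstanceAs (DecidableEq (Fin 14))

/-- The element of the witness system with the given label. -/
def mk (i : Fin 14) : Witness := i

/-- The up-set of each element, encoded as a bit mask. -/
def upset : Witness → ℕ :=
  (![6827, 4618, 16063, 8, 7738, 40, 4682, 640, 16363, 512, 7722, 6696, 4616, 16043] : Fin 14 → ℕ)

instance : LE Witness := ⟨fun i j => (upset i).testBit (Fin.val (n := 14) j) = true⟩

instance : DecidableRel (α := Witness) (· ≤ ·) := fun i j =>
  inferInstanceAs (Decidable ((upset i).testBit (Fin.val (n := 14) j) = true))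

instance : PartialOrder Witness where
  le_refl := by decide +kernel
  le_trans := by decide +kernel
  le_antisymm := by decide +kernel

/-- The involution of the witness system, exchanging consecutive labels. -/
def star : Witness → Witness :=
  (![1, 0, 3, 2, 5, 4, 7, 6, 9, 8, 11, 10, 13, 12] : Fin 14 → Fin 14)

end Witness

section Bounds

variable {P : Type*} [PartialOrder P] {r s t : P}

theorem isLUB_pair_iff :
    IsLUB {r, s} t ↔ r ≤ t ∧ s ≤ t ∧ ∀ m, r ≤ m → s ≤ m → t ≤ m := by
  simp [IsLUB, IsLeast, mem_lowerBounds, and_assoc]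

theorem isGLB_pair_iff :
    IsGLB {r, s} t ↔ t ≤ r ∧ t ≤ s ∧ ∀ m, m ≤ r → m ≤ s → m ≤ t := by
  simp [IsGLB, IsGreatest, mem_upperBounds, and_assoc]

/-- In an order-induced submodular system, the infimum of a pair without a supremum has strictly
smaller order than the first element of the pair. -/
theorem order_isGLB_lt_of_no_isLUB {U : Type*} [Lattice U] {φ : P → U}
    (hφ : ∀ r s, φ r ≤ φ s ↔ r ≤ s) (hinf : ∀ r s t, IsGLB {r, s} t → φ t = φ r ⊓ φ s)
    {f : U → ℝ} {k : ℝ} (hf : ∀ a b, f (a ⊔ b) + f (a ⊓ b) ≤ f a + f b)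
    (hrange : Set.range φ = {u | f u < k})
    (hglb : IsGLB {r, s} t) (hlub : ∀ m, ¬ IsLUB {r, s} m) : f (φ t) < f (φ r) := by
  have hsup : k ≤ f (φ r ⊔ φ s) := by
    by_contra! h
    obtain ⟨m, hm⟩ : φ r ⊔ φ s ∈ Set.range φ := hrange ▸ h
    refine hlub m (isLUB_pair_iff.2 ⟨?_, ?_, fun q hr hs => ?_⟩)
    · exact (hφ _ _).1 (hm ▸ le_sup_left)
    · exact (hφ _ _).1 (hm ▸ le_sup_right)
    · exact (hφ _ _).1 (hm ▸ sup_le ((hφ _ _).2 hr) ((hφ _ _).2 hs))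
  have hs : f (φ s) < k := (Set.ext_iff.1 hrange (φ s)).1 ⟨s, rfl⟩
  have := hf (φ r) (φ s)
  rw [← hinf r s t hglb] at this
  linarith

end Bounds

namespace Witness

/-- The witness system as a finite submodular separation system. -/
def sepSys : FinSubmodSepSys where
  carrier := Witness
  inv := star
  inv_invol := by decide +kernel
  inv_anti := by decide +kernel
  submod := by
    simp only [isLUB_pair_iff, isGLB_pair_iff]
    decide +kernel

theorem isGLB_zero_four : IsGLB {mk 0, mk 4} (mk 2) := by
  rw [isGLB_pair_iff]
  decide +kernel

theorem not_isLUB_zero_four : ∀ m, ¬ IsLUB {mk 0, mk 4} m := by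
  simp only [isLUB_pair_iff]
  decide +kernel

theorem isGLB_three_seven : IsGLB {mk 3, mk 7} (mk 0) := by
  rw [isGLB_pair_iff]
  decide +kernel

theorem not_isLUB_three_seven : ∀ m, ¬ IsLUB {mk 3, mk 7} m := by
  simp only [isLUB_pair_iff]
  decide +kernel

end Witness

/-- There is a (finite) submodular separation system which cannot be embedded
into any universe of separations, preserving the involution and pre-existing
binary joins and meets, so as to become order-induced submodular there. -/
theorem exists_submodular_sepSys_never_orderInduced :
    ∃ S : FinSubmodSepSys,
      ∀ (U : Type) [Lattice U], ∀ (inv : U → U) (φ : S.carrier → U),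
        (∀ u, inv (inv u) = u) →
        (∀ u v : U, u ≤ v → inv v ≤ inv u) →
        (∀ r s : S.carrier, φ r ≤ φ s ↔ r ≤ s) →
        (∀ s : S.carrier, φ (S.inv s) = inv (φ s)) →
        (∀ r s t : S.carrier, IsLUB {r, s} t → φ t = φ r ⊔ φ s) →
        (∀ r s t : S.carrier, IsGLB {r, s} t → φ t = φ r ⊓ φ s) →
        ¬ ∃ (f : U → ℝ) (k : ℝ), (∀ u, 0 ≤ f u) ∧
            (∀ a b : U, f (a ⊔ b) + f (a ⊓ b) ≤ f a + f b) ∧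
            (∀ u : U, f u = f (inv u)) ∧
            Set.range φ = {u : U | f u < k} := by
  refine ⟨Witness.sepSys, ?_⟩
  rintro U _ inv φ - - hφ hinv - hinf ⟨f, k, -, hf, hsymm, hrange⟩
  have h₂₀ := order_isGLB_lt_of_no_isLUB (P := Witness) hφ hinf hf hrange
    Witness.isGLB_zero_four Witness.not_isLUB_zero_four
  have h₀₃ := order_isGLB_lt_of_no_isLUB (P := Witness) hφ hinf hf hrange
    Witness.isGLB_three_seven Witness.not_isLUB_three_seven
  have h₃₂ : f (φ (Witness.mk 3)) = f (φ (Witness.mk 2)) :=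
    (congrArg f (hinv (Witness.mk 2))).trans (hsymm _).symm
  linarith
end

section
/- Let L be a finite lattice, let x ≤ y in L, and let L' = [x, y] = {z ∈ L | x ≤ z ≤ y}. Let f : L → ℝ be nonnegative, submodular on L' (f(a ⊔ b) + f(a ⊓ b) ≤ f(a) + f(b) for all a, b ∈ L'), and let k ∈ ℝ satisfy f(z) ≤ k for all z ∈ L'. Then there exists a nonnegative function g : L → ℝ which is submodular on all of L, satisfies g(z) = f(z) for all z ∈ L', and satisfies g(z) > k for all z ∈ L ∖ L'. -/
/-- A finite preorder carries a bounded function with values at least `K` which at least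
doubles along every strict descent. -/
theorem exists_doubling_along_descent (α : Type*) [Preorder α] [Finite α] {K : ℝ} (hK : 0 ≤ K) :
    ∃ (P : α → ℝ) (B : ℝ), (∀ z, K ≤ P z) ∧ (∀ z, P z ≤ B) ∧ ∀ a b, a < b → 2 * P b ≤ P a := by
  refine ⟨fun z => K * 2 ^ (Set.Ioi z).ncard, K * 2 ^ Nat.card α, fun z => ?_, fun z => ?_,
    fun a b hab => ?_⟩
  · exact le_mul_of_one_le_right hK (one_le_pow₀ one_le_two)
  · have h : (Set.Ioi z).ncard ≤ Nat.card α := Set.ncard_le_card _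
    dsimp only
    gcongr
    exact one_le_two
  · have h : (Set.Ioi b).ncard + 1 ≤ (Set.Ioi a).ncard :=
      Set.ncard_lt_ncard
        ((Set.ssubset_iff_of_subset (Set.Ioi_subset_Ioi hab.le)).2 ⟨b, hab, lt_irrefl b⟩)
        (Set.toFinite _)
    calc 2 * (K * 2 ^ (Set.Ioi b).ncard) = K * 2 ^ ((Set.Ioi b).ncard + 1) := by ring
      _ ≤ K * 2 ^ (Set.Ioi a).ncard := by
        gcongr
        exact one_le_two

/-- A nonnegative function which is submodular on an interval `[x, y]` of a
finite lattice, with maximum value at most `k` there, extends to a nonnegative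
submodular function on the whole lattice taking values above `k` outside
the interval. -/
theorem extend_submodular_from_interval {L : Type*} [Lattice L] [Finite L]
    (x y : L) (hxy : x ≤ y) (f : L → ℝ) (hf0 : ∀ z, 0 ≤ f z)
    (hsub : ∀ a ∈ Set.Icc x y, ∀ b ∈ Set.Icc x y,
      f (a ⊔ b) + f (a ⊓ b) ≤ f a + f b)
    (k : ℝ) (hk : ∀ z ∈ Set.Icc x y, f z ≤ k) :
    ∃ g : L → ℝ, (∀ z, 0 ≤ g z) ∧
      (∀ a b : L, g (a ⊔ b) + g (a ⊓ b) ≤ g a + g b) ∧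
      (∀ z ∈ Set.Icc x y, g z = f z) ∧
      (∀ z ∉ Set.Icc x y, k < g z) := by
  classical
  have hk0 : 0 ≤ k := (hf0 x).trans (hk x ⟨le_rfl, hxy⟩)
  obtain ⟨P, B, hPk, hPB, hP⟩ := exists_doubling_along_descent L (K := k + 1) (by linarith)
  obtain ⟨Q, C, hQk, hQC, hQ⟩ := exists_doubling_along_descent Lᵒᵈ (K := k + 1) (by linarith)
  replace hQ : ∀ a b : L, a < b → 2 * Q (OrderDual.toDual a) ≤ Q (OrderDual.toDual b) :=
    fun a b hab => hQ _ _ (OrderDual.toDual_lt_toDual.2 hab)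
  generalize hR : (fun z : L => Q (OrderDual.toDual z)) = R
  replace hQ : ∀ a b : L, a < b → 2 * R a ≤ R b := by subst hR; exact hQ
  have hRk : ∀ z, k + 1 ≤ R z := by subst hR; exact fun z => hQk _
  have hRC : ∀ z, R z ≤ C := by subst hR; exact fun z => hQC _
  -- Below `y` increase steeply, above `x` decrease steeply, elsewhere take a large constant.
  let g : L → ℝ := fun z =>
    if x ≤ z then if z ≤ y then f z else B + C + k + 1 - R z
    else if z ≤ y then B + C + k + 1 - P z else 2 * (B + C + k + 1)
  have hlt : ∀ z ∉ Set.Icc x y, k < g z := by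
    intro z hz
    have := hPk z; have := hPB z; have := hRk z; have := hRC z
    simp only [g]
    split_ifs with h1 h2
    · exact absurd ⟨h1, h2⟩ hz
    all_goals linarith
  refine ⟨g, fun z => ?_, fun a b => ?_, fun z hz => by simp [g, hz.1, hz.2], hlt⟩
  · by_cases hz : z ∈ Set.Icc x y
    · simpa [g, hz.1, hz.2] using hf0 z
    · exact hk0.trans (hlt z hz).le
  by_cases hab : a ≤ b
  · rw [sup_of_le_right hab, inf_of_le_left hab, add_comm]
  by_cases hba : b ≤ a
  · rw [sup_of_le_left hba, inf_of_le_right hba]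
  have hia := inf_lt_left.2 hab
  have hib := inf_lt_right.2 hba
  have hsa := left_lt_sup.2 hba
  have hsb := right_lt_sup.2 hab
  have := hP _ _ hia; have := hP _ _ hib; have := hP _ _ hsa; have := hP _ _ hsb
  have := hQ _ _ hia; have := hQ _ _ hib; have := hQ _ _ hsa; have := hQ _ _ hsb
  have := hPk a; have := hPk b; have := hPk (a ⊔ b); have := hPk (a ⊓ b)
  have := hPB a; have := hPB b; have := hPB (a ⊔ b); have := hPB (a ⊓ b)
  have := hRk a; have := hRk b; have := hRk (a ⊔ b); have := hRk (a ⊓ b)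
  have := hRC a; have := hRC b; have := hRC (a ⊔ b); have := hRC (a ⊓ b)
  have := hf0 a; have := hf0 b
  have hks := hk (a ⊔ b); have hki := hk (a ⊓ b)
  have hs := fun ha hb => hsub a ha b hb
  have hxa : x ≤ a → x ≤ a ⊔ b := fun h => h.trans le_sup_left
  have hxb : x ≤ b → x ≤ a ⊔ b := fun h => h.trans le_sup_right
  have hya : a ≤ y → a ⊓ b ≤ y := fun h => inf_le_left.trans h
  have hyb : b ≤ y → a ⊓ b ≤ y := fun h => inf_le_right.trans h
  simp only [Set.mem_Icc, le_inf_iff, sup_le_iff] at hks hki hs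
  simp only [g, le_inf_iff, sup_le_iff]
  by_cases h1 : x ≤ a <;> by_cases h2 : a ≤ y <;> by_cases h3 : x ≤ b <;> by_cases h4 : b ≤ y <;>
    by_cases h5 : x ≤ a ⊔ b <;> by_cases h6 : a ⊓ b ≤ y <;>
    simp only [h1, h2, h3, h4, h5, h6, and_true, and_self, and_false, if_true, if_false,
      forall_const, imp_false] at * <;>
    linarith
end

section
/- Let L be a finite distributive lattice with bottom element ⊥ and top element ⊤, and let L' ⊆ L be a sublattice (closed under ⊔ and ⊓) with ⊥ ∈ L' and ⊤ ∈ L'. Then there exists a nonnegative submodular function f : L → ℝ such that L' = {a ∈ L | f(a) = 0}. -/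
/-- The indicator of an interval `[u, v]` with `u` sup-prime and `v` inf-prime is submodular. -/
theorem submodular_indicator_Icc {L : Type*} [Lattice L] {u v : L}
    (hu : SupPrime u) (hv : InfPrime v) (a b : L) :
    (Set.Icc u v).indicator (1 : L → ℝ) (a ⊔ b) + (Set.Icc u v).indicator (1 : L → ℝ) (a ⊓ b) ≤
      (Set.Icc u v).indicator (1 : L → ℝ) a + (Set.Icc u v).indicator (1 : L → ℝ) b := by
  classical
  simp only [Set.indicator_apply, Set.mem_Icc, hu.le_sup, hv.inf_le, sup_le_iff, le_inf_iff,
    Pi.one_apply]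
  by_cases h₁ : u ≤ a <;> by_cases h₂ : u ≤ b <;> by_cases h₃ : a ≤ v <;>
    by_cases h₄ : b ≤ v <;> simp [h₁, h₂, h₃, h₄]

/-- An element outside a bounded sublattice of a finite distributive lattice lies in an interval
with sup-prime lower end and inf-prime upper end that misses the sublattice. -/
theorem exists_mem_Icc_disjoint_of_notMem {L : Type*} [DistribLattice L]
    [Finite L] [BoundedOrder L] {S : Set L}
    (hsup : ∀ a ∈ S, ∀ b ∈ S, a ⊔ b ∈ S)
    (hinf : ∀ a ∈ S, ∀ b ∈ S, a ⊓ b ∈ S)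
    (hbot : ⊥ ∈ S) (htop : ⊤ ∈ S) {a : L} (ha : a ∉ S) :
    ∃ u v, SupPrime u ∧ InfPrime v ∧ a ∈ Set.Icc u v ∧ Disjoint (Set.Icc u v) S := by
  by_contra! h
  obtain ⟨s, hs, hs'⟩ := exists_supIrred_decomposition a
  obtain ⟨t, ht, ht'⟩ := exists_infIrred_decomposition a
  have hsa : ∀ u ∈ s, u ≤ a := fun u hu => hs ▸ Finset.le_sup (f := id) hu
  have hta : ∀ v ∈ t, a ≤ v := fun v hv => ht ▸ Finset.inf_le (f := id) hv
  have hmeet : ∀ u ∈ s, ∀ v ∈ t, ∃ x, x ∈ Set.Icc u v ∧ x ∈ S := fun u hu v hv =>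
    Set.not_disjoint_iff.1 <|
      h u v (hs' hu).supPrime (ht' hv).infPrime ⟨hsa u hu, hta v hv⟩
  have hbelow : ∀ u ∈ s, ∃ y ∈ S, u ≤ y ∧ y ≤ a := by
    intro u hu
    choose! x hx hxS using hmeet u hu
    refine ⟨t.inf x, Finset.inf_mem S htop hinf t x hxS,
      Finset.le_inf fun v hv => (hx v hv).1, ?_⟩
    rw [← ht]
    exact Finset.inf_mono_fun fun v hv => (hx v hv).2
  choose! y hyS huy hya using hbelow
  have hay : s.sup y = a := by
    refine le_antisymm (Finset.sup_le hya) ?_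
    rw [← hs]
    exact Finset.sup_mono_fun huy
  exact ha (hay ▸ Finset.sup_mem S hbot hsup s y hyS)

/-- For every sublattice `L'` of a finite distributive lattice `L` containing
the top and bottom elements, there is a nonnegative submodular function on `L`
vanishing exactly on `L'`. -/
theorem sublattice_zero_set_of_submodular {L : Type*} [DistribLattice L]
    [Finite L] [BoundedOrder L] (L' : Set L)
    (hsup : ∀ a ∈ L', ∀ b ∈ L', a ⊔ b ∈ L')
    (hinf : ∀ a ∈ L', ∀ b ∈ L', a ⊓ b ∈ L')
    (hbot : (⊥ : L) ∈ L') (htop : (⊤ : L) ∈ L') :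
    ∃ f : L → ℝ, (∀ a, 0 ≤ f a) ∧
      (∀ a b : L, f (a ⊔ b) + f (a ⊓ b) ≤ f a + f b) ∧
      L' = {a : L | f a = 0} := by
  classical
  have := Fintype.ofFinite L
  let P : Finset (L × L) :=
    {p | SupPrime p.1 ∧ InfPrime p.2 ∧ Disjoint (Set.Icc p.1 p.2) L'}
  have hnonneg : ∀ (p : L × L) (a : L), 0 ≤ (Set.Icc p.1 p.2).indicator (1 : L → ℝ) a :=
    fun p a => Set.indicator_nonneg (fun _ _ => zero_le_one) a
  refine ⟨fun a => ∑ p ∈ P, (Set.Icc p.1 p.2).indicator 1 a,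
    fun a => Finset.sum_nonneg fun p _ => hnonneg p a, fun a b => ?_, ?_⟩
  · simp only [← Finset.sum_add_distrib]
    refine Finset.sum_le_sum fun p hp => ?_
    obtain ⟨hu, hv, -⟩ := (Finset.mem_filter.1 hp).2
    exact submodular_indicator_Icc hu hv a b
  · ext a
    rw [Set.mem_ofPred_eq, Finset.sum_eq_zero_iff_of_nonneg fun p _ => hnonneg p a]
    constructor
    · intro ha p hp
      obtain ⟨-, -, hd⟩ := (Finset.mem_filter.1 hp).2
      exact Set.indicator_of_notMem (Set.disjoint_right.1 hd ha) _
    · intro h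
      by_contra ha
      obtain ⟨u, v, hu, hv, hmem, hd⟩ :=
        exists_mem_Icc_disjoint_of_notMem hsup hinf hbot htop ha
      have h₀ := h (u, v) (Finset.mem_filter.2 ⟨Finset.mem_univ _, hu, hv, hd⟩)
      simp [Set.indicator_of_mem hmem] at h₀
end

section
/- Let L be a finite distributive lattice and let L' ⊆ L be a nonempty sublattice (closed under ⊔ and ⊓). Then there exist a nonnegative submodular function f : L → ℝ and k ∈ ℝ with k ≥ 0 such that L' = {a ∈ L | f(a) ≤ k}. -/
open Classical in
/-- The indicator of `φ ∧ ¬ ψ` is submodular for lattice homomorphisms `φ`, `ψ` to `Prop`. -/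
lemma LatticeHom.submodular_indicator {L : Type*} [Lattice L] (φ ψ : LatticeHom L Prop)
    (a b : L) :
    ((if φ (a ⊔ b) ∧ ¬ ψ (a ⊔ b) then 1 else 0) + (if φ (a ⊓ b) ∧ ¬ ψ (a ⊓ b) then 1 else 0) : ℝ) ≤
      (if φ a ∧ ¬ ψ a then 1 else 0) + (if φ b ∧ ¬ ψ b then 1 else 0) := by
  simp only [map_sup, map_inf, sup_Prop_eq, inf_Prop_eq]
  by_cases h₁ : φ a <;> by_cases h₂ : φ b <;> by_cases h₃ : ψ a <;> by_cases h₄ : ψ b <;>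
    simp [h₁, h₂, h₃, h₄]

/-- Lattice homomorphisms to `Prop` detect the order of a finite distributive lattice. -/
lemma le_of_forall_latticeHom_prop {L : Type*} [DistribLattice L] [Finite L] {a b : L}
    (h : ∀ φ : LatticeHom L Prop, φ a → φ b) : a ≤ b := by
  obtain ⟨α, _, _, i, hi⟩ := exists_birkhoff_representation L
  have hle : i a ≤ i b := fun s hs ↦
    h { toFun := fun x ↦ s ∈ i x
        map_sup' := fun x y ↦ by simp
        map_inf' := fun x y ↦ by simp } hs
  rw [← inf_eq_left, ← map_inf] at hle
  exact inf_eq_left.1 (hi hle)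

/-- A nonempty sublattice of a finite distributive lattice is cut out by implications between
lattice homomorphisms to `Prop`. -/
lemma mem_of_forall_latticeHom_prop {L : Type*} [DistribLattice L] [Finite L] {S : Set L}
    (hsup : ∀ a ∈ S, ∀ b ∈ S, a ⊔ b ∈ S) (hinf : ∀ a ∈ S, ∀ b ∈ S, a ⊓ b ∈ S) {a : L}
    (h : ∀ φ ψ : LatticeHom L Prop, (∀ x ∈ S, φ x → ψ x) → φ a → ψ a) : a ∈ S := by
  classical
  have : Nonempty L := ⟨a⟩
  have : Finite (LatticeHom L Prop) := DFunLike.finite _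
  have := Fintype.ofFinite (LatticeHom L Prop)
  have key (φ : LatticeHom L Prop) (hφ : φ a) : ∃ x ∈ S, φ x ∧ x ≤ a := by
    have hex (ψ : LatticeHom L Prop) (hψ : ¬ ψ a) : ∃ x ∈ S, φ x ∧ ¬ ψ x := by
      by_contra! hc
      exact hψ (h φ ψ hc hφ)
    choose! g hgS hgφ hgψ using hex
    let T : Finset (LatticeHom L Prop) := {ψ | ¬ ψ a}
    have hT : T.Nonempty := ⟨⟨⟨fun _ ↦ False, by simp⟩, by simp⟩,
      Finset.mem_filter.2 ⟨Finset.mem_univ _, not_false⟩⟩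
    refine ⟨T.inf' hT g, Finset.inf'_mem S hinf T hT g fun ψ hψ ↦ hgS ψ (by simpa [T] using hψ),
      Finset.inf'_mem {x | φ x} (fun x hx y hy ↦ ?_) T hT g
        fun ψ hψ ↦ hgφ ψ (by simpa [T] using hψ), le_of_forall_latticeHom_prop fun ψ hx ↦ ?_⟩
    · simpa using And.intro hx hy
    · by_contra hψ
      exact hgψ ψ hψ (OrderHomClass.mono ψ (Finset.inf'_le g (by simpa [T] using hψ)) hx)
  choose! g hgS hgφ hga using key
  let T : Finset (LatticeHom L Prop) := {φ | φ a}
  have hT : T.Nonempty := ⟨⟨⟨fun _ ↦ True, by simp⟩, by simp⟩,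
    Finset.mem_filter.2 ⟨Finset.mem_univ _, trivial⟩⟩
  have hEq : T.sup' hT g = a := by
    refine le_antisymm (Finset.sup'_le hT g fun φ hφ ↦ hga φ (by simpa [T] using hφ))
      (le_of_forall_latticeHom_prop fun φ hφ ↦ ?_)
    exact OrderHomClass.mono φ (Finset.le_sup' g (by simpa [T] using hφ)) (hgφ φ hφ)
  exact hEq ▸ Finset.sup'_mem S hsup T hT g fun φ hφ ↦ hgS φ (by simpa [T] using hφ)


/-- For every nonempty sublattice `L'` of a finite distributive lattice `L`
there are a nonnegative submodular function `f` on `L` and a threshold `k ≥ 0`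
with `L' = {a | f a ≤ k}`. -/
theorem sublattice_is_sublevel_set_of_submodular {L : Type*} [DistribLattice L]
    [Finite L] (L' : Set L) (hne : L'.Nonempty)
    (hsup : ∀ a ∈ L', ∀ b ∈ L', a ⊔ b ∈ L')
    (hinf : ∀ a ∈ L', ∀ b ∈ L', a ⊓ b ∈ L') :
    ∃ (f : L → ℝ) (k : ℝ), 0 ≤ k ∧ (∀ a, 0 ≤ f a) ∧
      (∀ a b : L, f (a ⊔ b) + f (a ⊓ b) ≤ f a + f b) ∧
      L' = {a : L | f a ≤ k} := by
  classical
  have : Finite (LatticeHom L Prop) := DFunLike.finite _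
  have := Fintype.ofFinite (LatticeHom L Prop)
  let P : Finset (LatticeHom L Prop × LatticeHom L Prop) := {p | ∀ x ∈ L', p.1 x → p.2 x}
  have hnonneg (a : L) : ∀ p ∈ P, (0 : ℝ) ≤ if p.1 a ∧ ¬ p.2 a then 1 else 0 :=
    fun p _ ↦ by split_ifs <;> norm_num
  refine ⟨fun a ↦ ∑ p ∈ P, if p.1 a ∧ ¬ p.2 a then 1 else 0, 0, le_rfl,
    fun a ↦ Finset.sum_nonneg (hnonneg a), fun a b ↦ ?_, ?_⟩
  · simp only [← Finset.sum_add_distrib]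
    exact Finset.sum_le_sum fun p _ ↦ p.1.submodular_indicator p.2 a b
  · ext a
    refine ⟨fun ha ↦ Set.mem_ofPred.2 (Finset.sum_eq_zero fun p hp ↦ ?_).le, fun ha ↦ ?_⟩
    · have := (Finset.mem_filter.1 hp).2 a ha
      exact if_neg fun h ↦ h.2 (this h.1)
    · have hzero := (Finset.sum_eq_zero_iff_of_nonneg (hnonneg a)).1
        (le_antisymm ha (Finset.sum_nonneg (hnonneg a)))
      refine mem_of_forall_latticeHom_prop hsup hinf fun φ ψ hφψ hφ ↦ ?_
      by_contra hψ
      simpa [hφ, hψ] using hzero (φ, ψ) (by simpa [P] using hφψ)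
end

section
/- Let U be a finite distributive lattice equipped with an involutive antitone map star : U → U, and let U' ⊆ U be a nonempty subset closed under ⊔, ⊓, and star. Then there exist a nonnegative submodular function f : U → ℝ with f(u) = f(star u) for all u ∈ U, and k ∈ ℝ with k ≥ 0, such that U' = {u ∈ U | f(u) ≤ k}. -/
/-- On a finite distributive lattice, every sublattice `S` is the zero set of
a nonnegative submodular function, namely the gap in rank between an element and the least
element of `S` (with a new top element adjoined) above it. -/
theorem exists_submodular_zero_set {U : Type*} [DistribLattice U] [Finite U] (S : Sublattice U) :
    ∃ f : U → ℝ, (∀ u, 0 ≤ f u) ∧ (∀ a b, f (a ⊔ b) + f (a ⊓ b) ≤ f a + f b) ∧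
      ∀ u, f u = 0 ↔ u ∈ S := by
  classical
  have := Fintype.ofFinite U
  obtain ⟨β, _, _, e, he⟩ := exists_birkhoff_representation (WithTop U)
  have e_mono : Monotone e := OrderHomClass.mono e
  let rank (a : WithTop U) : ℝ := (e a).card
  have rank_mono : Monotone rank := fun a b hab ↦
    Nat.cast_le.2 (Finset.card_le_card (e_mono hab))
  have rank_add (a b : WithTop U) : rank (a ⊔ b) + rank (a ⊓ b) = rank a + rank b := by
    simp only [rank, map_sup, map_inf]
    exact_mod_cast Finset.card_union_add_card_inter _ _
  let cl (u : U) : WithTop U := {y | y ∈ S ∧ u ≤ y}.toFinset.inf (↑)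
  have le_cl (u : U) : (u : WithTop U) ≤ cl u :=
    Finset.le_inf fun y hy ↦ WithTop.coe_le_coe.2 (by simpa using hy : y ∈ S ∧ u ≤ y).2
  have cl_le {u y : U} (hy : y ∈ S) (huy : u ≤ y) : cl u ≤ y :=
    Finset.inf_le (f := ((↑) : U → WithTop U)) (by simp [hy, huy])
  have cl_mono : Monotone cl := fun a b hab ↦ Finset.le_inf fun y hy ↦ by
    have hy : y ∈ S ∧ b ≤ y := by simpa using hy
    exact cl_le hy.1 (hab.trans hy.2)
  have cl_sup (a b : U) : cl (a ⊔ b) ≤ cl a ⊔ cl b := by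
    simp only [cl, Finset.inf_sup_inf]
    refine Finset.le_inf fun p hp ↦ ?_
    have hp : (p.1 ∈ S ∧ a ≤ p.1) ∧ p.2 ∈ S ∧ b ≤ p.2 := by simpa using hp
    rw [← WithTop.coe_sup]
    exact cl_le (S.supClosed hp.1.1 hp.2.1) (sup_le_sup hp.1.2 hp.2.2)
  have cl_mem (u : U) : cl u = ⊤ ∨ ∃ y ∈ S, cl u = y := by
    refine Finset.inf_induction (p := fun a : WithTop U ↦ a = ⊤ ∨ ∃ y ∈ S, a = y) (.inl rfl) ?_ ?_
    · rintro a (rfl | ⟨y, hy, rfl⟩) b (rfl | ⟨z, hz, rfl⟩)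
      · simp
      · exact .inr ⟨z, hz, by simp⟩
      · exact .inr ⟨y, hy, by simp⟩
      · exact .inr ⟨y ⊓ z, S.infClosed hy hz, by simp⟩
    · intro y hy
      exact .inr ⟨y, (by simpa using hy : y ∈ S ∧ u ≤ y).1, rfl⟩
  refine ⟨fun u ↦ rank (cl u) - rank u, fun u ↦ sub_nonneg.2 (rank_mono (le_cl u)),
    fun a b ↦ ?_, fun u ↦ ⟨fun h ↦ ?_, fun h ↦ ?_⟩⟩
  · have h₁ := rank_mono (cl_sup a b)
    have h₂ := rank_mono
      (le_inf (cl_mono inf_le_left) (cl_mono inf_le_right) : cl (a ⊓ b) ≤ cl a ⊓ cl b)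
    have h₃ := rank_add (cl a) (cl b)
    have h₄ : rank ↑(a ⊔ b) + rank ↑(a ⊓ b) = rank a + rank b := rank_add a b
    linarith
  · have hcard : (e (cl u)).card = (e u).card := Nat.cast_injective (R := ℝ) (sub_eq_zero.1 h)
    have hu : (u : WithTop U) = cl u :=
      he (Finset.eq_of_subset_of_card_le (e_mono (le_cl u)) hcard.le)
    obtain htop | ⟨y, hy, hcl⟩ := cl_mem u
    · exact absurd (hu.trans htop) WithTop.coe_ne_top
    · rwa [WithTop.coe_injective (hu.trans hcl)]
  · simp [(cl_le h le_rfl).antisymm (le_cl u)]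

/-- For every nonempty subuniverse `U'` of a finite distributive universe of
separations `U` there are a submodular order function `f` on `U` and a
threshold `k ≥ 0` with `U' = {u | f u ≤ k}`. -/
theorem subuniverse_is_sublevel_set_of_submodular_order_function {U : Type*}
    [DistribLattice U] [Finite U] (star : U → U)
    (hinv : ∀ u, star (star u) = u)
    (hanti : ∀ u v : U, u ≤ v → star v ≤ star u)
    (U' : Set U) (hne : U'.Nonempty)
    (hsup : ∀ a ∈ U', ∀ b ∈ U', a ⊔ b ∈ U')
    (hinf : ∀ a ∈ U', ∀ b ∈ U', a ⊓ b ∈ U')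
    (hstar : ∀ a ∈ U', star a ∈ U') :
    ∃ (f : U → ℝ) (k : ℝ), 0 ≤ k ∧ (∀ u, 0 ≤ f u) ∧
      (∀ a b : U, f (a ⊔ b) + f (a ⊓ b) ≤ f a + f b) ∧
      (∀ u : U, f u = f (star u)) ∧
      U' = {u : U | f u ≤ k} := by
  let starIso : U ≃o Uᵒᵈ :=
    { toFun := fun u ↦ OrderDual.toDual (star u)
      invFun := fun u ↦ star (OrderDual.ofDual u)
      left_inv := hinv
      right_inv := hinv
      map_rel_iff' := fun {a b} ↦
        ⟨fun h ↦ hinv a ▸ hinv b ▸ hanti (star b) (star a) h, hanti a b⟩ }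
  have star_sup (a b : U) : star (a ⊔ b) = star a ⊓ star b := starIso.map_sup a b
  have star_inf (a b : U) : star (a ⊓ b) = star a ⊔ star b := starIso.map_inf a b
  obtain ⟨g, g_nonneg, g_submod, g_zero⟩ := exists_submodular_zero_set
    (⟨U', fun a ha b hb ↦ hsup a ha b hb, fun a ha b hb ↦ hinf a ha b hb⟩ : Sublattice U)
  refine ⟨fun u ↦ g u + g (star u), 0, le_rfl, fun u ↦ add_nonneg (g_nonneg _) (g_nonneg _),
    fun a b ↦ ?_, fun u ↦ ?_, Set.ext fun u ↦ ⟨fun hu ↦ ?_, fun hu ↦ ?_⟩⟩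
  · have h₁ := g_submod a b
    have h₂ := g_submod (star a) (star b)
    simp only [star_sup, star_inf]
    linarith
  · simp only [hinv, add_comm]
  · exact (add_eq_zero_iff_of_nonneg (g_nonneg _) (g_nonneg _)).2
      ⟨(g_zero u).2 hu, (g_zero _).2 (hstar u hu)⟩ |>.le
  · refine (g_zero u).1 (le_antisymm ?_ (g_nonneg u))
    have h : g u + g (star u) ≤ 0 := hu
    linarith [g_nonneg (star u)]
end

section
/- Let U be a finite lattice with an involutive antitone map star : U → U, let x ∈ U satisfy x ≤ star x, and let U' = [x, star x] = {z ∈ U | x ≤ z ≤ star x} (note that U' is closed under star). Let f : U → ℝ be nonnegative, submodular on U' (f(a ⊔ b) + f(a ⊓ b) ≤ f(a) + f(b) for all a, b ∈ U'), satisfy f(z) = f(star z) for all z ∈ U', and let k ∈ ℝ satisfy f(z) ≤ k for all z ∈ U'. Then there exists a nonnegative function g : U → ℝ which is submodular on all of U, satisfies g(z) = g(star z) for all z ∈ U, agrees with f on U' (g(z) = f(z) for z ∈ U'), and satisfies g(z) > k for all z ∈ U ∖ U'. -/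
open scoped Classical in
/-- The indicator of not lying below `y`. -/
noncomputable def notLEIndicator {U : Type*} [LE U] (y u : U) : ℝ :=
  if u ≤ y then 0 else 1

theorem notLEIndicator_nonneg {U : Type*} [LE U] (y u : U) : 0 ≤ notLEIndicator y u := by
  unfold notLEIndicator; split_ifs <;> norm_num

theorem notLEIndicator_submodular {U : Type*} [Lattice U] (y a b : U) :
    notLEIndicator y (a ⊔ b) + notLEIndicator y (a ⊓ b) ≤
      notLEIndicator y a + notLEIndicator y b := by
  unfold notLEIndicator
  by_cases ha : a ≤ y <;> by_cases hb : b ≤ y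
  · simp [ha, hb, sup_le ha hb, inf_le_of_left_le ha]
  · have hab : ¬ a ⊔ b ≤ y := fun h => hb (le_sup_right.trans h)
    simp [hb, hab, ha, inf_le_of_left_le ha]
  · have hab : ¬ a ⊔ b ≤ y := fun h => ha (le_sup_left.trans h)
    simp [ha, hab, hb, inf_le_of_right_le hb]
  · have hab : ¬ a ⊔ b ≤ y := fun h => ha (le_sup_left.trans h)
    simp only [ha, hb, hab, if_false]
    split_ifs <;> norm_num

open scoped Classical in
/-- The number of elements that lie neither above `x` nor above `u`. -/
noncomputable def notGECount {U : Type*} [LE U] [Fintype U] (x u : U) : ℝ :=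
  ∑ y with ¬ x ≤ y, notLEIndicator y u

theorem notGECount_nonneg {U : Type*} [LE U] [Fintype U] (x u : U) : 0 ≤ notGECount x u :=
  Finset.sum_nonneg fun y _ => notLEIndicator_nonneg y u

theorem notGECount_eq_of_le {U : Type*} [Preorder U] [Fintype U] {x u : U} (h : x ≤ u) :
    notGECount x u = notGECount x x := by
  refine Finset.sum_congr rfl fun y hy => ?_
  have hy : ¬ x ≤ y := by simpa using hy
  have hu : ¬ u ≤ y := fun hu => hy (h.trans hu)
  simp [notLEIndicator, hy, hu]

theorem notGECount_submodular {U : Type*} [Lattice U] [Fintype U] (x a b : U) :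
    notGECount x (a ⊔ b) + notGECount x (a ⊓ b) ≤ notGECount x a + notGECount x b := by
  simp only [notGECount, ← Finset.sum_add_distrib]
  exact Finset.sum_le_sum fun y _ => notLEIndicator_submodular y a b

/-- Submodularity of `notGECount` is strict, with gap one, on incomparable elements
whose infimum is not above `x`. -/
theorem notGECount_submodular_gap {U : Type*} [Lattice U] [Fintype U] {x a b : U}
    (hab : ¬ a ≤ b) (hba : ¬ b ≤ a) (hx : ¬ x ≤ a ⊓ b) :
    notGECount x (a ⊔ b) + notGECount x (a ⊓ b) + 1 ≤ notGECount x a + notGECount x b := by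
  classical
  have hmem : a ⊓ b ∈ Finset.univ.filter fun y => ¬ x ≤ y := by simpa using hx
  simp only [notGECount, ← Finset.sum_add_distrib]
  rw [← Finset.add_sum_erase _ _ hmem, ← Finset.add_sum_erase _ _ hmem]
  have hrest := Finset.sum_le_sum (s := (Finset.univ.filter fun y => ¬ x ≤ y).erase (a ⊓ b))
    fun y _ => notLEIndicator_submodular y a b
  have hgap : notLEIndicator (a ⊓ b) (a ⊔ b) + notLEIndicator (a ⊓ b) (a ⊓ b) + 1 ≤
      notLEIndicator (a ⊓ b) a + notLEIndicator (a ⊓ b) b := by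
    simp [notLEIndicator, hab, hba]
  linarith

/-- An antitone involution of a lattice exchanges suprema and infima. -/
theorem antitone_involution_sup {U : Type*} [Lattice U] {star : U → U}
    (hinv : ∀ u, star (star u) = u) (hanti : ∀ u v : U, u ≤ v → star v ≤ star u) (a b : U) :
    star (a ⊔ b) = star a ⊓ star b := by
  refine le_antisymm (le_inf (hanti _ _ le_sup_left) (hanti _ _ le_sup_right)) ?_
  rw [← hinv (star a ⊓ star b)]
  refine hanti _ _ (sup_le ?_ ?_)
  · simpa only [hinv] using hanti _ _ (inf_le_left : star a ⊓ star b ≤ star a)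
  · simpa only [hinv] using hanti _ _ (inf_le_right : star a ⊓ star b ≤ star b)

theorem antitone_involution_inf {U : Type*} [Lattice U] {star : U → U}
    (hinv : ∀ u, star (star u) = u) (hanti : ∀ u v : U, u ≤ v → star v ≤ star u) (a b : U) :
    star (a ⊓ b) = star a ⊔ star b := by
  rw [← hinv (star a ⊔ star b), antitone_involution_sup hinv hanti, hinv, hinv]


/-- A submodular order function defined on a symmetric interval `[x, star x]`
of a finite universe of separations, with maximum value at most `k` there,
extends to a submodular order function on the whole universe taking values
above `k` outside the interval. -/
theorem extend_submodular_order_function_from_symmetric_interval {U : Type*}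
    [Lattice U] [Finite U] (star : U → U)
    (hinv : ∀ u, star (star u) = u)
    (hanti : ∀ u v : U, u ≤ v → star v ≤ star u)
    (x : U) (hx : x ≤ star x) (f : U → ℝ) (hf0 : ∀ z, 0 ≤ f z)
    (hsub : ∀ a ∈ Set.Icc x (star x), ∀ b ∈ Set.Icc x (star x),
      f (a ⊔ b) + f (a ⊓ b) ≤ f a + f b)
    (hsym : ∀ z ∈ Set.Icc x (star x), f z = f (star z))
    (k : ℝ) (hk : ∀ z ∈ Set.Icc x (star x), f z ≤ k) :
    ∃ g : U → ℝ, (∀ z, 0 ≤ g z) ∧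
      (∀ a b : U, g (a ⊔ b) + g (a ⊓ b) ≤ g a + g b) ∧
      (∀ z : U, g z = g (star z)) ∧
      (∀ z ∈ Set.Icc x (star x), g z = f z) ∧
      (∀ z ∉ Set.Icc x (star x), k < g z) := by
  classical
  have := Fintype.ofFinite U
  have hsup := antitone_involution_sup hinv hanti
  have hinf := antitone_involution_inf hinv hanti
  have hstar : ∀ u, x ≤ star u ↔ u ≤ star x := fun u =>
    ⟨fun h => by simpa only [hinv] using hanti _ _ h,
      fun h => by simpa only [hinv] using hanti _ _ h⟩
  have hstar' : ∀ u, star u ≤ star x ↔ x ≤ u := fun u => by rw [← hstar, hinv]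
  have hmem : ∀ u, star u ∈ Set.Icc x (star x) ↔ u ∈ Set.Icc x (star x) := fun u => by
    rw [Set.mem_Icc, Set.mem_Icc, hstar, hstar', and_comm]
  have hk0 : 0 ≤ k := (hf0 x).trans (hk x ⟨le_rfl, hx⟩)
  set c := notGECount x x with hc
  have hc0 : 0 ≤ c := notGECount_nonneg x x
  -- `f` extended by zero, a strictly submodular correction, and a penalty off the interval
  let e : U → ℝ := fun u => if u ∈ Set.Icc x (star x) then f u else 0
  let H : U → ℝ := fun u => notGECount x u + notGECount x (star u)
  let d : U → ℝ := fun u => notLEIndicator (star x) u + notLEIndicator (star x) (star u)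
  have he0 : ∀ u, 0 ≤ e u := fun u => by
    simp only [e]; split_ifs
    exacts [hf0 u, le_rfl]
  have hek : ∀ u, e u ≤ k := fun u => by
    simp only [e]; split_ifs with h
    exacts [hk u h, hk0]
  have hH0 : ∀ u, 0 ≤ H u := fun u =>
    add_nonneg (notGECount_nonneg _ _) (notGECount_nonneg _ _)
  have hd : ∀ u ∉ Set.Icc x (star x), 1 ≤ d u := fun u hu => by
    simp only [d, notLEIndicator, hstar']
    rw [Set.mem_Icc] at hu
    by_cases h₁ : x ≤ u <;> by_cases h₂ : u ≤ star x
    · exact absurd ⟨h₁, h₂⟩ hu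
    all_goals norm_num [h₁, h₂]
  have hdsub : ∀ a b, d (a ⊔ b) + d (a ⊓ b) ≤ d a + d b := fun a b => by
    have h₁ := notLEIndicator_submodular (star x) a b
    have h₂ := notLEIndicator_submodular (star x) (star a) (star b)
    simp only [d, hsup, hinf]
    linarith
  have hHgap : ∀ a b, ¬ a ≤ b → ¬ b ≤ a →
      ¬ (a ∈ Set.Icc x (star x) ∧ b ∈ Set.Icc x (star x)) →
      H (a ⊔ b) + H (a ⊓ b) + 1 ≤ H a + H b := fun a b hab hba hI => by
    have h₁ := notGECount_submodular x a b
    have h₂ := notGECount_submodular x (star a) (star b)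
    simp only [H, hsup, hinf]
    by_cases hxab : x ≤ a ⊓ b
    · have hsab : ¬ x ≤ star a ⊓ star b := fun h => by
        rw [le_inf_iff] at hxab
        rw [le_inf_iff, hstar, hstar] at h
        exact hI ⟨⟨hxab.1, h.1⟩, hxab.2, h.2⟩
      have := notGECount_submodular_gap (a := star a) (b := star b)
        (fun h => hba (by simpa only [hinv] using hanti _ _ h))
        (fun h => hab (by simpa only [hinv] using hanti _ _ h)) hsab
      linarith
    · have := notGECount_submodular_gap hab hba hxab
      linarith
  have hN : 0 ≤ 2 * k * (2 * c) + k + 1 := by positivity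
  let g : U → ℝ := fun u => e u + 2 * k * (H u - 2 * c) + (2 * k * (2 * c) + k + 1) * d u
  have hgin : ∀ z ∈ Set.Icc x (star x), g z = f z := fun z hz => by
    have hH : H z = 2 * c := by
      simp only [H]
      rw [notGECount_eq_of_le hz.1, notGECount_eq_of_le ((hmem z).2 hz).1, ← hc]
      ring
    have hdz : d z = 0 := by
      simp [d, notLEIndicator, hz.2, ((hmem z).2 hz).2]
    have hez : e z = f z := if_pos hz
    simp only [g, hH, hdz, hez]
    ring
  have hgout : ∀ z ∉ Set.Icc x (star x), k < g z := fun z hz => by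
    have h₁ := mul_le_mul_of_nonneg_left (hd z hz) hN
    have h₂ : 0 ≤ 2 * k * H z := mul_nonneg (by positivity) (hH0 z)
    have h₃ := he0 z
    simp only [g]
    linarith
  refine ⟨g, fun z => ?_, fun a b => ?_, fun z => ?_, hgin, hgout⟩
  · by_cases hz : z ∈ Set.Icc x (star x)
    · rw [hgin z hz]; exact hf0 z
    · exact hk0.trans (hgout z hz).le
  · by_cases hab : a ≤ b
    · rw [sup_eq_right.2 hab, inf_eq_left.2 hab, add_comm]
    by_cases hba : b ≤ a
    · rw [sup_eq_left.2 hba, inf_eq_right.2 hba]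
    by_cases hI : a ∈ Set.Icc x (star x) ∧ b ∈ Set.Icc x (star x)
    · obtain ⟨ha, hb⟩ := hI
      rw [hgin a ha, hgin b hb, hgin _ ⟨le_sup_of_le_left ha.1, sup_le ha.2 hb.2⟩,
        hgin _ ⟨le_inf ha.1 hb.1, inf_le_of_left_le ha.2⟩]
      exact hsub a ha b hb
    · have h₁ := mul_le_mul_of_nonneg_left (hHgap a b hab hba hI)
        (by positivity : 0 ≤ 2 * k)
      have h₂ := mul_le_mul_of_nonneg_left (hdsub a b) hN
      have h₃ := hek (a ⊔ b)
      have h₄ := hek (a ⊓ b)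
      have h₅ := he0 a
      have h₆ := he0 b
      simp only [g]
      linarith
  · have hez : e (star z) = e z := by
      simp only [e, hmem]
      split_ifs with h
      exacts [(hsym z h).symm, rfl]
    simp only [g, hez, H, d, hinv]
    ring
end

section
/- Let V be a finite type and let S be a set of subsets of V closed under complementation (A ∈ S implies V ∖ A ∈ S). Suppose S contains at least three unoriented bipartitions, i.e., there exist A, B, C ∈ S which are pairwise neither equal nor complementary (A ≠ B, A ≠ V ∖ B, A ≠ C, A ≠ V ∖ C, B ≠ C, B ≠ V ∖ C). Then there exist sets S₁, S₂, S₃, each a proper subset of S, each closed under complementation, and each corner-closed in S (for all X, Y ∈ Sᵢ, if X ∪ Y ∈ S then X ∪ Y ∈ Sᵢ), such that S₁ ∪ S₂ ∪ S₃ = S. -/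
/-- Two nontrivial bipartitions that are neither equal nor complementary have at least three
nonempty corners, so they separate some three points pairwise. -/
theorem exists_three_pairwise_separated {V : Type*} {A B : Set V}
    (hA : A ≠ ∅) (hA' : A ≠ Set.univ) (hB : B ≠ ∅) (hB' : B ≠ Set.univ)
    (hAB : A ≠ B) (hAB' : A ≠ Bᶜ) :
    ∃ x y z : V, ¬((x ∈ A ↔ y ∈ A) ∧ (x ∈ B ↔ y ∈ B)) ∧
      ¬((y ∈ A ↔ z ∈ A) ∧ (y ∈ B ↔ z ∈ B)) ∧ ¬((x ∈ A ↔ z ∈ A) ∧ (x ∈ B ↔ z ∈ B)) := by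
  obtain ⟨a, ha⟩ := Set.nonempty_iff_ne_empty.mpr hA
  obtain ⟨a', ha'⟩ := (Set.ne_univ_iff_exists_notMem A).mp hA'
  obtain ⟨b, hb⟩ := Set.nonempty_iff_ne_empty.mpr hB
  obtain ⟨b', hb'⟩ := (Set.ne_univ_iff_exists_notMem B).mp hB'
  obtain ⟨r, hr⟩ : ∃ r, ¬(r ∈ A ↔ r ∈ B) := by
    by_contra! h
    exact hAB (Set.ext h)
  obtain ⟨s, hs⟩ : ∃ s, ¬(s ∈ A ↔ s ∉ B) := by
    by_contra! h
    exact hAB' (Set.ext h)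
  by_contra! h
  have h₁ := h r s a
  have h₂ := h r s a'
  have h₃ := h r s b
  have h₄ := h r s b'
  grind

/-- The bipartitions in `S` that do not separate `x` from `y`. -/
def nonseparating {V : Type*} (S : Set (Set V)) (x y : V) : Set (Set V) :=
  {X ∈ S | x ∈ X ↔ y ∈ X}

theorem nonseparating_ssubset {V : Type*} {S : Set (Set V)} {A B : Set V} {x y : V}
    (hA : A ∈ S) (hB : B ∈ S) (h : ¬((x ∈ A ↔ y ∈ A) ∧ (x ∈ B ↔ y ∈ B))) :
    nonseparating S x y ⊂ S :=
  ⟨fun _ hX => hX.1, fun hS => h ⟨(hS hA).2, (hS hB).2⟩⟩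

theorem compl_mem_nonseparating {V : Type*} {S : Set (Set V)} (hcompl : ∀ A ∈ S, Aᶜ ∈ S)
    (x y : V) : ∀ X ∈ nonseparating S x y, Xᶜ ∈ nonseparating S x y :=
  fun X hX => ⟨hcompl X hX.1, not_congr hX.2⟩

theorem union_mem_nonseparating {V : Type*} (S : Set (Set V)) (x y : V) :
    ∀ X ∈ nonseparating S x y, ∀ Y ∈ nonseparating S x y,
      X ∪ Y ∈ S → X ∪ Y ∈ nonseparating S x y :=
  fun _ hX _ hY hXY => ⟨hXY, or_congr hX.2 hY.2⟩

/-- Each bipartition has two of any three points on the same side. -/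
theorem nonseparating_union {V : Type*} (S : Set (Set V)) (x y z : V) :
    nonseparating S x y ∪ nonseparating S y z ∪ nonseparating S x z = S := by
  ext X
  simp only [nonseparating, Set.mem_union, Set.mem_ofPred_eq]
  tauto

/-- Every subsystem of a bipartition universe containing at least three
unoriented bipartitions is the union of three proper corner-closed
subsystems. -/
theorem bipartition_system_decomposes_into_three {V : Type*} [Finite V]
    (S : Set (Set V)) (hcompl : ∀ A ∈ S, Aᶜ ∈ S)
    (A B C : Set V) (hA : A ∈ S) (hB : B ∈ S) (hC : C ∈ S)
    (hAB : A ≠ B) (hAB' : A ≠ Bᶜ) (hAC : A ≠ C) (hAC' : A ≠ Cᶜ)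
    (hBC : B ≠ C) (hBC' : B ≠ Cᶜ) :
    ∃ S₁ S₂ S₃ : Set (Set V),
      S₁ ⊂ S ∧ S₂ ⊂ S ∧ S₃ ⊂ S ∧
      (∀ X ∈ S₁, Xᶜ ∈ S₁) ∧ (∀ X ∈ S₂, Xᶜ ∈ S₂) ∧ (∀ X ∈ S₃, Xᶜ ∈ S₃) ∧
      (∀ X ∈ S₁, ∀ Y ∈ S₁, X ∪ Y ∈ S → X ∪ Y ∈ S₁) ∧
      (∀ X ∈ S₂, ∀ Y ∈ S₂, X ∪ Y ∈ S → X ∪ Y ∈ S₂) ∧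
      (∀ X ∈ S₃, ∀ Y ∈ S₃, X ∪ Y ∈ S → X ∪ Y ∈ S₃) ∧
      S₁ ∪ S₂ ∪ S₃ = S := by
  obtain ⟨D, hD, E, hE, x, y, z, hxy, hyz, hxz⟩ : ∃ D ∈ S, ∃ E ∈ S, ∃ x y z : V,
      ¬((x ∈ D ↔ y ∈ D) ∧ (x ∈ E ↔ y ∈ E)) ∧ ¬((y ∈ D ↔ z ∈ D) ∧ (y ∈ E ↔ z ∈ E)) ∧
        ¬((x ∈ D ↔ z ∈ D) ∧ (x ∈ E ↔ z ∈ E)) := by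
    have hc : (∅ : Set V)ᶜ = Set.univ := Set.compl_empty
    have hc' : (Set.univ : Set V)ᶜ = ∅ := Set.compl_univ
    by_cases h₁ : A = ∅ ∨ A = Set.univ
    · exact ⟨B, hB, C, hC, exists_three_pairwise_separated (by grind) (by grind) (by grind)
        (by grind) hBC hBC'⟩
    by_cases h₂ : B = ∅ ∨ B = Set.univ
    · exact ⟨A, hA, C, hC, exists_three_pairwise_separated (by grind) (by grind) (by grind)
        (by grind) hAC hAC'⟩
    · exact ⟨A, hA, B, hB, exists_three_pairwise_separated (by grind) (by grind) (by grind)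
        (by grind) hAB hAB'⟩
  exact ⟨nonseparating S x y, nonseparating S y z, nonseparating S x z,
    nonseparating_ssubset hD hE hxy, nonseparating_ssubset hD hE hyz,
    nonseparating_ssubset hD hE hxz, compl_mem_nonseparating hcompl x y,
    compl_mem_nonseparating hcompl y z, compl_mem_nonseparating hcompl x z,
    union_mem_nonseparating S x y, union_mem_nonseparating S y z,
    union_mem_nonseparating S x z, nonseparating_union S x y z⟩
end

section
/- Let U be a finite distributive lattice equipped with an involutive antitone map star : U → U, and let J be the set of sup-irreducible elements of U. Then there exists an involutive antitone map inv : J → J such that for every a ∈ U and every p ∈ J: p ≤ star(a) if and only if it is not the case that inv(p) ≤ a. (Equivalently, the Birkhoff isomorphism a ↦ {p ∈ J | p ≤ a} from U to the lattice of lower sets of J carries star to the involution X ↦ {p ∈ J | inv(p) ∉ X}.) -/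
/-- An inf-closed nonempty upper set in a finite lattice is principal. -/
theorem IsUpperSet.exists_eq_Ici_of_infClosed {α : Type*} [Lattice α] [Finite α] {s : Set α}
    (hs : IsUpperSet s) (hne : s.Nonempty) (hinf : InfClosed s) : ∃ q, s = Set.Ici q := by
  obtain ⟨q, hq⟩ := s.toFinite.exists_minimal hne
  exact ⟨q, Set.Subset.antisymm
    (fun u hu => (hq.le_of_le (hinf hq.prop hu) inf_le_left).trans inf_le_right)
    fun u hu => hs hu hq.prop⟩

/-- An antitone involution of a lattice, as an order isomorphism onto the order dual. -/
def OrderIso.ofAntitoneInvolutive {α : Type*} [PartialOrder α] (star : α → α)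
    (hstar : Function.Involutive star) (hanti : Antitone star) : α ≃o αᵒᵈ where
  toEquiv := hstar.toPerm.trans OrderDual.toDual
  map_rel_iff' {a b} := ⟨fun h => by
    have h' : star b ≤ star a := h
    simpa only [hstar a, hstar b] using hanti h', fun h => hanti h⟩

/-- For `p` sup-prime in a finite lattice with antitone involution `star`, there is a
sup-irreducible `q` such that `q ≤ a` exactly when `p` is not below `star a`. -/
theorem SupPrime.exists_supIrred_le_iff_not_le_star {α : Type*} [Lattice α] [Finite α]
    {star : α → α} (hstar : Function.Involutive star) (hanti : Antitone star) {p : α}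
    (hp : SupPrime p) : ∃ q, SupIrred q ∧ ∀ a, q ≤ a ↔ ¬ p ≤ star a := by
  have map_inf (a b : α) : star (a ⊓ b) = star a ⊔ star b :=
    (OrderIso.ofAntitoneInvolutive star hstar hanti).map_inf a b
  have map_sup (a b : α) : star (a ⊔ b) = star a ⊓ star b :=
    (OrderIso.ofAntitoneInvolutive star hstar hanti).map_sup a b
  obtain ⟨q, hq⟩ := IsUpperSet.exists_eq_Ici_of_infClosed (s := {a | ¬ p ≤ star a})
    (fun a b hab ha hb => ha (hb.trans (hanti hab)))
    (by
      obtain ⟨b, hb⟩ := not_isMin_iff.1 hp.not_isMin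
      exact ⟨star b, by simpa only [Set.mem_ofPred_eq, hstar b] using hb.not_ge⟩)
    (fun a ha b hb => by
      simp only [Set.mem_ofPred_eq, map_inf, hp.le_sup, not_or] at ha hb ⊢
      exact ⟨ha, hb⟩)
  have hq' (a : α) : q ≤ a ↔ ¬ p ≤ star a := (Set.ext_iff.1 hq a).symm
  refine ⟨q, ⟨fun hmin => ?_, fun b c hbc => ?_⟩, hq'⟩
  · exact (hq' (star p)).1 ((hmin inf_le_left).trans inf_le_right) (hstar p).ge
  · by_contra! h
    have hb : ¬ q ≤ b := fun hle => h.1 (le_antisymm (hbc ▸ le_sup_left) hle)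
    have hc : ¬ q ≤ c := fun hle => h.2 (le_antisymm (hbc ▸ le_sup_right) hle)
    rw [hq', not_not] at hb hc
    exact (hq' (b ⊔ c)).1 hbc.ge (map_sup b c ▸ le_inf hb hc)

/-- Birkhoff representation for finite distributive universes of separations:
the involution `star` of a finite distributive lattice `U` is induced by an
involutive antitone map on the poset of sup-irreducible elements of `U`, via
`p ≤ star a ↔ ¬ inv p ≤ a`. -/
theorem birkhoff_representation_of_universes {U : Type*} [DistribLattice U]
    [Finite U] (star : U → U) (hstar : ∀ u, star (star u) = u)
    (hanti : ∀ u v : U, u ≤ v → star v ≤ star u) :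
    ∃ inv : {p : U // SupIrred p} → {p : U // SupIrred p},
      (∀ p, inv (inv p) = p) ∧
      (∀ p q : {p : U // SupIrred p}, p ≤ q → inv q ≤ inv p) ∧
      (∀ (a : U) (p : {p : U // SupIrred p}),
        (p : U) ≤ star a ↔ ¬ ((inv p : U) ≤ a)) := by
  have key (p : {p : U // SupIrred p}) :
      ∃ q : {p : U // SupIrred p}, ∀ a, (q : U) ≤ a ↔ ¬ (p : U) ≤ star a := by
    obtain ⟨q, hq, h⟩ := (supPrime_iff_supIrred.2 p.2).exists_supIrred_le_iff_not_le_star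
      hstar (fun u v => hanti u v)
    exact ⟨⟨q, hq⟩, h⟩
  choose inv hinv using key
  refine ⟨inv, fun p => Subtype.ext (eq_of_forall_ge_iff fun a => ?_), fun p q hpq => ?_,
    fun a p => by rw [hinv, not_not]⟩
  · rw [hinv, hinv, not_not, hstar]
  · exact (hinv q _).2 fun h => (hinv p _).1 le_rfl (le_trans hpq h)
end

section
/- Let P be a finite partially ordered set and let σ be an involutive antitone map on the lattice of lower sets of P (σ(σ(X)) = X for all lower sets X, and X ⊆ Y implies σ(Y) ⊆ σ(X)). Then for every lower set X of P, the cardinality of σ(X) as a subset of P equals |P| − |X|. -/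
namespace LowerSet

variable {P : Type*} [PartialOrder P] [Finite P]

/-- Between any two comparable lower sets of a finite poset there is a chain adding one element at
a time, so a strictly antitone `ℕ`-valued function drops at least as fast as the cardinality
grows. -/
theorem add_ncard_le_add_ncard_of_strictAnti {f : LowerSet P → ℕ} (hf : StrictAnti f)
    {X Y : LowerSet P} (h : X ≤ Y) :
    f Y + (Y : Set P).ncard ≤ f X + (X : Set P).ncard := by
  induction Y using WellFoundedLT.induction with
  | ind Y ih =>
    obtain rfl | hlt := h.eq_or_lt
    · exact le_rfl
    obtain ⟨a, ha⟩ := (Set.toFinite ((Y : Set P) \ X)).exists_maximal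
      (Set.sdiff_nonempty.2 fun hYX => hlt.not_ge hYX)
    have haY : a ∈ Y := ha.prop.1
    have haX : a ∉ X := ha.prop.2
    have hcoe : (Y.erase a : Set P) = (Y : Set P) \ {a} := by
      ext x
      simp only [coe_erase, Set.mem_sdiff, UpperSet.mem_Ici_iff, SetLike.mem_coe,
        Set.mem_singleton_iff]
      refine and_congr_right fun hx => not_congr ⟨fun hax => ?_, fun hxa => hxa.ge⟩
      exact (ha.le_of_ge ⟨hx, fun hxX => haX (X.lower hax hxX)⟩ hax).antisymm hax
    have hYa : Y.erase a < Y := erase_lt.2 haY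
    have hXa : X ≤ Y.erase a := fun x hx => ⟨h hx, fun hax => haX (X.lower hax hx)⟩
    have hcard := Set.ncard_sdiff_singleton_add_one haY (Set.toFinite _)
    rw [← hcoe] at hcard
    have hstep := hf hYa
    have := ih _ hYa hXa
    omega

end LowerSet

/-- For any involutive antitone map `σ` on the lattice of lower sets of a
finite poset `P`, the image `σ X` of a lower set `X` has cardinality
`|P| - |X|`. -/
theorem card_image_of_lowerSet_involution {P : Type*} [PartialOrder P]
    [Finite P] (σ : LowerSet P → LowerSet P)
    (hinv : ∀ X, σ (σ X) = X)
    (hanti : ∀ X Y : LowerSet P, X ≤ Y → σ Y ≤ σ X)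
    (X : LowerSet P) :
    Nat.card (σ X : Set P) = Nat.card P - Nat.card (X : Set P) := by
  have hσ : StrictAnti fun Y => (σ Y : Set P).ncard := fun Y Z hYZ =>
    Set.ncard_lt_ncard (lt_of_le_of_ne (hanti _ _ hYZ.le) fun h =>
      hYZ.ne' (by rw [← hinv Z, SetLike.coe_injective h, hinv])) (Set.toFinite _)
  have hbot := LowerSet.add_ncard_le_add_ncard_of_strictAnti hσ (bot_le (a := X))
  have htop := LowerSet.add_ncard_le_add_ncard_of_strictAnti hσ (le_top (a := X))
  have hle := Set.ncard_le_card (σ ⊥ : Set P)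
  simp only [LowerSet.coe_bot, LowerSet.coe_top, Set.ncard_empty, Set.ncard_univ] at hbot htop
  simp only [Nat.card_coe_set_eq]
  omega
end

section
/- Let U be a finite distributive lattice with an involutive antitone map star : U → U, and let S ⊆ U be closed under star and submodular in U (for all r, s ∈ S, r ⊔ s ∈ S or r ⊓ s ∈ S). Suppose there exist three elements s₁, s₂, s₃ ∈ S which are pairwise neither equal nor inverse to one another (sᵢ ≠ sⱼ and sᵢ ≠ star(sⱼ) for i ≠ j). Then there exist sets S₁, S₂, S₃, each a proper subset of S, each closed under star, and each corner-closed in S (for all r, t ∈ Sᵢ with r ⊔ t ∈ S we have r ⊔ t ∈ Sᵢ) — hence each submodular in U — such that S₁ ∪ S₂ ∪ S₃ = S. -/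
/-- Prime separation: distinct elements of a distributive lattice are distinguished by a
lattice homomorphism to `Prop`. -/
theorem exists_latticeHom_prop_separating {U : Type*} [DistribLattice U] {a b : U}
    (hab : a ≠ b) : ∃ p : LatticeHom U Prop, ¬ (p a ↔ p b) := by
  have key : ∀ u v : U, ¬ u ≤ v → ∃ p : LatticeHom U Prop, p u ∧ ¬ p v := by
    intro u v huv
    have hdisj : Disjoint (Order.PFilter.principal u : Set U) (Order.Ideal.principal v : Set U) :=
      Set.disjoint_left.2 fun w hw hw' => huv
        ((Order.PFilter.mem_principal.1 hw).trans (Order.Ideal.mem_principal.1 hw'))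
    obtain ⟨I, hI, hvI, hIu⟩ := DistribLattice.prime_ideal_of_disjoint_filter_ideal hdisj
    refine ⟨{ toFun := fun w => w ∉ I, map_sup' := ?_, map_inf' := ?_ }, ?_, ?_⟩
    · intro x y
      apply propext
      change x ⊔ y ∉ I ↔ x ∉ I ∨ y ∉ I
      rw [Order.Ideal.sup_mem_iff, not_and_or]
    · intro x y
      apply propext
      change x ⊓ y ∉ I ↔ x ∉ I ∧ y ∉ I
      rw [← not_or]
      exact not_congr ⟨hI.mem_or_mem, fun h =>
        h.elim (I.lower inf_le_left) (I.lower inf_le_right)⟩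
    · exact fun hu => Set.disjoint_left.1 hIu (Order.PFilter.mem_principal.2 le_rfl) hu
    · exact fun hv => hv (hvI (Order.Ideal.mem_principal.2 le_rfl))
  by_cases h : a ≤ b
  · obtain ⟨p, hp⟩ := key b a fun h' => hab (le_antisymm h h')
    exact ⟨p, fun hiff => hp.2 (hiff.2 hp.1)⟩
  · obtain ⟨p, hp⟩ := key a b h
    exact ⟨p, fun hiff => hp.2 (hiff.1 hp.1)⟩

/-- The predicate `c` is compatible with the lattice operations, and with `star` on `S`, and it
fails somewhere on `S`. -/
structure CutsOutProperSubsystem {U : Type*} [Lattice U] (star : U → U) (S : Set U)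
    (c : U → Prop) : Prop where
  sup : ∀ r t, c r → c t → c (r ⊔ t)
  inf : ∀ r t, c r → c t → c (r ⊓ t)
  star : ∀ s ∈ S, c s → c (star s)
  proper : ∃ s ∈ S, ¬ c s

theorem CutsOutProperSubsystem.isCornerClosed {U : Type*} [Lattice U] {star : U → U} {S : Set U}
    {c : U → Prop} (hc : CutsOutProperSubsystem star S c) (hstarS : ∀ s ∈ S, star s ∈ S)
    (hsubmod : ∀ r ∈ S, ∀ s ∈ S, r ⊔ s ∈ S ∨ r ⊓ s ∈ S) :
    {s ∈ S | c s} ⊂ S ∧ (∀ s ∈ {s ∈ S | c s}, star s ∈ {s ∈ S | c s}) ∧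
      (∀ r ∈ {s ∈ S | c s}, ∀ t ∈ {s ∈ S | c s}, r ⊔ t ∈ S → r ⊔ t ∈ {s ∈ S | c s}) ∧
      (∀ r ∈ {s ∈ S | c s}, ∀ t ∈ {s ∈ S | c s},
        r ⊔ t ∈ {s ∈ S | c s} ∨ r ⊓ t ∈ {s ∈ S | c s}) := by
  refine ⟨⟨fun s hs => hs.1, fun h => ?_⟩, fun s hs => ⟨hstarS s hs.1, hc.star s hs.1 hs.2⟩,
    fun r hr t ht h => ⟨h, hc.sup r t hr.2 ht.2⟩, fun r hr t ht => ?_⟩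
  · obtain ⟨s, hs, hcs⟩ := hc.proper
    exact hcs (h hs).2
  · exact (hsubmod r hr.1 t ht.1).imp (fun h => ⟨h, hc.sup r t hr.2 ht.2⟩)
      fun h => ⟨h, hc.inf r t hr.2 ht.2⟩

/-- The agreement set of two lattice homomorphisms to `Prop`, both of which are Boolean on `S`,
cuts out a proper subsystem as soon as some element of `S` distinguishes them. -/
theorem cutsOutProperSubsystem_agree {U : Type*} [Lattice U] {star : U → U} {S : Set U}
    {p q : LatticeHom U Prop} (hp : ∀ s ∈ S, (p (star s) ↔ ¬ p s))
    (hq : ∀ s ∈ S, (q (star s) ↔ ¬ q s)) (hpq : ∃ s ∈ S, ¬ (p s ↔ q s)) :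
    CutsOutProperSubsystem star S fun s => p s ↔ q s where
  sup r t hr ht := by
    simp only [map_sup, sup_Prop_eq]
    exact or_congr hr ht
  inf r t hr ht := by
    simp only [map_inf, inf_Prop_eq]
    exact and_congr hr ht
  star s hs h := by rw [hp s hs, hq s hs, h]
  proper := hpq


/-- Every separation system with at least three unoriented separations which is
submodular in a finite distributive universe of separations is the union of
three proper corner-closed (hence submodular) subsystems. -/
theorem submodular_system_decomposes_into_three {U : Type*} [DistribLattice U]
    [Finite U] (star : U → U) (hinv : ∀ u, star (star u) = u)
    (hanti : ∀ u v : U, u ≤ v → star v ≤ star u)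
    (S : Set U) (hstarS : ∀ s ∈ S, star s ∈ S)
    (hsubmod : ∀ r ∈ S, ∀ s ∈ S, r ⊔ s ∈ S ∨ r ⊓ s ∈ S)
    (s₁ s₂ s₃ : U) (h₁ : s₁ ∈ S) (h₂ : s₂ ∈ S) (h₃ : s₃ ∈ S)
    (h₁₂ : s₁ ≠ s₂) (h₁₂' : s₁ ≠ star s₂) (h₁₃ : s₁ ≠ s₃) (h₁₃' : s₁ ≠ star s₃)
    (h₂₃ : s₂ ≠ s₃) (h₂₃' : s₂ ≠ star s₃) :
    ∃ S₁ S₂ S₃ : Set U,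
      S₁ ⊂ S ∧ S₂ ⊂ S ∧ S₃ ⊂ S ∧
      (∀ s ∈ S₁, star s ∈ S₁) ∧ (∀ s ∈ S₂, star s ∈ S₂) ∧
      (∀ s ∈ S₃, star s ∈ S₃) ∧
      (∀ r ∈ S₁, ∀ t ∈ S₁, r ⊔ t ∈ S → r ⊔ t ∈ S₁) ∧
      (∀ r ∈ S₂, ∀ t ∈ S₂, r ⊔ t ∈ S → r ⊔ t ∈ S₂) ∧
      (∀ r ∈ S₃, ∀ t ∈ S₃, r ⊔ t ∈ S → r ⊔ t ∈ S₃) ∧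
      (∀ r ∈ S₁, ∀ t ∈ S₁, r ⊔ t ∈ S₁ ∨ r ⊓ t ∈ S₁) ∧
      (∀ r ∈ S₂, ∀ t ∈ S₂, r ⊔ t ∈ S₂ ∨ r ⊓ t ∈ S₂) ∧
      (∀ r ∈ S₃, ∀ t ∈ S₃, r ⊔ t ∈ S₃ ∨ r ⊓ t ∈ S₃) ∧
      S₁ ∪ S₂ ∪ S₃ = S := by
  have hsup : ∀ a b, star (a ⊔ b) = star a ⊓ star b := fun a b => by
    refine le_antisymm (le_inf (hanti _ _ le_sup_left) (hanti _ _ le_sup_right)) ?_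
    rw [← hinv (star a ⊓ star b)]
    apply hanti
    refine sup_le ?_ ?_
    · simpa only [hinv] using hanti _ _ (inf_le_left : star a ⊓ star b ≤ star a)
    · simpa only [hinv] using hanti _ _ (inf_le_right : star a ⊓ star b ≤ star b)
  have hinf : ∀ a b, star (a ⊓ b) = star a ⊔ star b := fun a b => by
    rw [← hinv (star a ⊔ star b), hsup, hinv, hinv]
  suffices h : ∃ c₁ c₂ c₃ : U → Prop, CutsOutProperSubsystem star S c₁ ∧
      CutsOutProperSubsystem star S c₂ ∧ CutsOutProperSubsystem star S c₃ ∧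
      ∀ s ∈ S, c₁ s ∨ c₂ s ∨ c₃ s by
    obtain ⟨c₁, c₂, c₃, hc₁, hc₂, hc₃, hcover⟩ := h
    obtain ⟨a₁, b₁, d₁, e₁⟩ := hc₁.isCornerClosed hstarS hsubmod
    obtain ⟨a₂, b₂, d₂, e₂⟩ := hc₂.isCornerClosed hstarS hsubmod
    obtain ⟨a₃, b₃, d₃, e₃⟩ := hc₃.isCornerClosed hstarS hsubmod
    refine ⟨_, _, _, a₁, a₂, a₃, b₁, b₂, b₃, d₁, d₂, d₃, e₁, e₂, e₃, ?_⟩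
    ext s
    simp only [Set.mem_union, Set.mem_ofPred_eq]
    have := hcover s
    tauto
  -- For each homomorphism `p`, three star-closed sublattices cover the lattice.
  by_cases hsplit : ∃ p : LatticeHom U Prop, (∃ s ∈ S, ¬ (p (star s) ↔ ¬ p s)) ∧
      (∃ s ∈ S, ¬ (p s ∧ p (star s))) ∧ ∃ s ∈ S, ¬ (¬ p s ∧ ¬ p (star s))
  · obtain ⟨p, hp₁, hp₂, hp₃⟩ := hsplit
    refine ⟨fun s => p (star s) ↔ ¬ p s, fun s => p s ∧ p (star s),
      fun s => ¬ p s ∧ ¬ p (star s), ⟨?_, ?_, ?_, hp₁⟩, ⟨?_, ?_, ?_, hp₂⟩,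
      ⟨?_, ?_, ?_, hp₃⟩, fun s _ => by clear * -; grind⟩ <;>
      simp only [hsup, hinf, hinv, map_sup, map_inf, sup_Prop_eq, inf_Prop_eq] <;> clear * - <;> grind
  have hconst : ∀ p : LatticeHom U Prop, (∀ s ∈ S, (p (star s) ↔ ¬ p s)) ∨
      (∀ s ∈ S, ∀ t ∈ S, (p s ↔ p t)) := by
    intro p
    by_cases hp₁ : ∃ s ∈ S, ¬ (p (star s) ↔ ¬ p s)
    · by_cases hp₂ : ∃ s ∈ S, ¬ (p s ∧ p (star s))
      · have hp₃ : ∀ s ∈ S, ¬ p s := fun s hs hps =>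
          hsplit ⟨p, hp₁, hp₂, s, hs, fun h => h.1 hps⟩
        exact Or.inr fun s hs t ht => iff_of_false (hp₃ s hs) (hp₃ t ht)
      · have hp₂' : ∀ s ∈ S, p s := fun s hs => by
          by_contra hps
          exact hp₂ ⟨s, hs, fun h => hps h.1⟩
        exact Or.inr fun s hs t ht => iff_of_true (hp₂' s hs) (hp₂' t ht)
    · exact Or.inl fun s hs => by
        by_contra h
        exact hp₁ ⟨s, hs, h⟩
  have hsep : ∀ a ∈ S, ∀ b ∈ S, a ≠ b → ∃ p : LatticeHom U Prop,
      (∀ s ∈ S, (p (star s) ↔ ¬ p s)) ∧ ¬ (p a ↔ p b) := by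
    intro a ha b hb hab
    obtain ⟨p, hp⟩ := exists_latticeHom_prop_separating hab
    exact ⟨p, (hconst p).resolve_right fun h => hp (h a ha b hb), hp⟩
  obtain ⟨p, hp, hp₁₂⟩ := hsep s₁ h₁ s₂ h₂ h₁₂
  obtain ⟨q, hq, hq₁₂⟩ := hsep s₁ h₁ _ (hstarS _ h₂) h₁₂'
  have hpq : ∃ s ∈ S, ¬ (p s ↔ q s) := by
    have := hq s₂ h₂
    by_cases h : p s₁ ↔ q s₁
    · exact ⟨s₂, h₂, by clear * - this h hp₁₂ hq₁₂; grind⟩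
    · exact ⟨s₁, h₁, h⟩
  by_cases hthird : ∃ r : LatticeHom U Prop, (∀ s ∈ S, (r (star s) ↔ ¬ r s)) ∧
      (∃ s ∈ S, ¬ (p s ↔ r s)) ∧ ∃ s ∈ S, ¬ (q s ↔ r s)
  · obtain ⟨r, hr, hpr, hqr⟩ := hthird
    exact ⟨_, _, _, cutsOutProperSubsystem_agree hp hq hpq, cutsOutProperSubsystem_agree hp hr hpr,
      cutsOutProperSubsystem_agree hq hr hqr, fun s _ => by clear * -; grind⟩
  -- Otherwise `p` and `q` determine the elements of `S`.
  exfalso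
  have hdet : ∀ a ∈ S, ∀ b ∈ S, (p a ↔ p b) → (q a ↔ q b) → a = b := by
    intro a ha b hb hpab hqab
    by_contra hab
    obtain ⟨r, hr, hrab⟩ := hsep a ha b hb hab
    apply hthird
    refine ⟨r, hr, ?_, ?_⟩ <;> by_contra! h
    · exact hrab (by rw [← h a ha, ← h b hb, hpab])
    · exact hrab (by rw [← h a ha, ← h b hb, hqab])
  have hs₃ := hstarS _ h₃
  have := hdet _ h₁ _ h₃
  have := hdet _ h₁ _ hs₃
  have := hdet _ h₂ _ h₃
  have := hdet _ h₂ _ hs₃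
  have := hp _ h₃
  have := hq _ h₃
  have := hq _ h₂
  clear hconst hsep hthird hdet hsplit hp hq hsubmod hstarS hsup hinf hinv hanti hpq
  grind
end
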